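/- arXiv:2501.02854 — 6 statements merged into one kernel-verified Lean document; each statement's English description precedes it below -/
import Mathlib

section
/- Assume hypotheses (Ha) and (G), let 𝓘 ⊆ {1,…,n} be nonempty, and let w ∈ C([0,L]) be 𝓘-admissible. Then for every λ < 0 there exists a constant R_λ > 0 such that every function u ∈ C²([0,L]) with u ≥ 0, u(0) = u(L) = 0, and −u''(x) = λ u(x) + a(x) u(x)^p + μ w(x) for all x ∈ (0,L), satisfies ‖u‖_{L^∞([0,L])} < R_λ, regardless of the value of μ ≥ 0. -/
open Set

/-- The `L^∞`-norm of a function on a set: `sup` of `|v|`. -/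
noncomputable def supNorm (v : ℝ → ℝ) (K : Set ℝ) : ℝ :=
  sSup ((fun x => |v x|) '' K)

theorem concaveOn_sub_sq_of_second_deriv_le {s t C : ℝ} (c : ℝ) {u u' u'' : ℝ → ℝ}
    (hu : ContinuousOn u (Icc s t))
    (hu' : ∀ x ∈ Ioo s t, HasDerivAt u (u' x) x)
    (hu'' : ∀ x ∈ Ioo s t, HasDerivAt u' (u'' x) x)
    (hle : ∀ x ∈ Ioo s t, u'' x ≤ C) :
    ConcaveOn ℝ (Icc s t) (fun x => u x - C / 2 * (x - c) ^ 2) := by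
  refine concaveOn_of_hasDerivWithinAt2_nonpos (f' := fun x => u' x - C * (x - c))
    (f'' := fun x => u'' x - C) (convex_Icc s t) (hu.sub (by fun_prop)) ?_ ?_ ?_
  · intro x hx
    rw [interior_Icc] at hx
    have h := (((hasDerivAt_id x).sub_const c).pow 2).const_mul (C / 2)
    refine (((hu' x hx).sub h).congr_deriv ?_).hasDerivWithinAt
    simp
    ring
  · intro x hx
    rw [interior_Icc] at hx
    have h := ((hasDerivAt_id x).sub_const c).const_mul C
    refine (((hu'' x hx).sub h).congr_deriv ?_).hasDerivWithinAt
    simp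
  · intro x hx
    rw [interior_Icc] at hx
    linarith [hle x hx]

/-- If `u'' ≤ M K` and `0 ≤ u`, with `u x = K` and `M (y - x)² ≤ 1`, then `u ≥ K / 2` on the first
third of the segment from `x` to `y`. -/
theorem half_le_of_second_deriv_le {s t M K x y θ : ℝ} {u u' u'' : ℝ → ℝ}
    (hM : 0 ≤ M) (hK : 0 ≤ K)
    (hu : ContinuousOn u (Icc s t))
    (hu' : ∀ x ∈ Ioo s t, HasDerivAt u (u' x) x)
    (hu'' : ∀ x ∈ Ioo s t, HasDerivAt u' (u'' x) x)
    (hle : ∀ x ∈ Ioo s t, u'' x ≤ M * K)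
    (hx : x ∈ Icc s t) (hy : y ∈ Icc s t) (hxK : u x = K) (huy : 0 ≤ u y)
    (hxy : M * (y - x) ^ 2 ≤ 1) (hθ0 : 0 ≤ θ) (hθ : θ ≤ 1 / 3) :
    K / 2 ≤ u (x + θ * (y - x)) := by
  have h := (concaveOn_sub_sq_of_second_deriv_le x hu hu' hu'' hle).2 hx hy
    (by linarith : 0 ≤ 1 - θ) hθ0 (by ring)
  have e : (1 - θ) • x + θ • y = x + θ * (y - x) := by
    simp only [smul_eq_mul]
    ring
  rw [e] at h
  simp only [smul_eq_mul, hxK] at h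
  have h1 : θ * K * (M * (y - x) ^ 2) ≤ θ * K * 1 :=
    mul_le_mul_of_nonneg_left hxy (mul_nonneg hθ0 hK)
  have h2 : 0 ≤ M * K / 2 * (x + θ * (y - x) - x) ^ 2 := by positivity
  have h3 : θ * K ≤ 1 / 3 * K := mul_le_mul_of_nonneg_right hθ hK
  have h4 : 0 ≤ θ * u y := mul_nonneg hθ0 huy
  nlinarith

/-- A function with values in `[0, K]` cannot satisfy `u'' ≤ C` with `C` very negative. -/
theorem neg_second_deriv_bound_le {A d K C : ℝ} {u u' u'' : ℝ → ℝ} (hd : 0 < d)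
    (hu : ContinuousOn u (Icc A (A + d)))
    (hu' : ∀ x ∈ Ioo A (A + d), HasDerivAt u (u' x) x)
    (hu'' : ∀ x ∈ Ioo A (A + d), HasDerivAt u' (u'' x) x)
    (hle : ∀ x ∈ Ioo A (A + d), u'' x ≤ C)
    (hpos : ∀ x ∈ Icc A (A + d), 0 ≤ u x) (hK : ∀ x ∈ Icc A (A + d), u x ≤ K) :
    -C ≤ 8 * K / d ^ 2 := by
  have hl : A ∈ Icc A (A + d) := ⟨le_rfl, by linarith⟩
  have hr : A + d ∈ Icc A (A + d) := ⟨by linarith, le_rfl⟩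
  have h := (concaveOn_sub_sq_of_second_deriv_le (A + d / 2) hu hu' hu'' hle).2 hl hr
    (by norm_num : (0 : ℝ) ≤ 1 / 2) (by norm_num : (0 : ℝ) ≤ 1 / 2) (by norm_num)
  have e : (1 / 2 : ℝ) • A + (1 / 2 : ℝ) • (A + d) = A + d / 2 := by
    simp only [smul_eq_mul]
    ring
  rw [e] at h
  simp only [smul_eq_mul] at h
  have hm := hK (A + d / 2) ⟨by linarith, by linarith⟩
  rw [le_div_iff₀ (by positivity)]
  nlinarith [hpos _ hl, hpos _ hr]

/-- A priori bound, without boundary conditions, for nonnegative solutions of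
`u'' ≤ M u - a u ^ p` on an interval in whose interior `a` is positive. -/
theorem exists_bound_of_pos_coeff {s t M p : ℝ} (hst : s < t) (hM : 0 ≤ M) (hp : 1 < p)
    {a : ℝ → ℝ} (ha : ContinuousOn a (Icc s t)) (hapos : ∀ x ∈ Ioo s t, 0 < a x) :
    ∃ R : ℝ, ∀ u u' u'' : ℝ → ℝ, ContinuousOn u (Icc s t) →
      (∀ x ∈ Ioo s t, HasDerivAt u (u' x) x) →
      (∀ x ∈ Ioo s t, HasDerivAt u' (u'' x) x) →
      (∀ x ∈ Icc s t, 0 ≤ u x) →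
      (∀ x ∈ Ioo s t, u'' x ≤ M * u x - a x * u x ^ p) →
      ∀ x ∈ Icc s t, u x ≤ R := by
  obtain ⟨h, hh, hhl, hMh⟩ : ∃ h : ℝ, 0 < h ∧ h ≤ (t - s) / 2 ∧ M * h ^ 2 ≤ 1 := by
    refine ⟨min ((t - s) / 2) (1 / (M + 1)), lt_min (by linarith) (by positivity),
      min_le_left _ _, ?_⟩
    have hle : min ((t - s) / 2) (1 / (M + 1)) ≤ 1 / (M + 1) := min_le_right _ _
    have hpos : 0 < min ((t - s) / 2) (1 / (M + 1)) := lt_min (by linarith) (by positivity)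
    set h := min ((t - s) / 2) (1 / (M + 1))
    rw [le_div_iff₀ (by positivity)] at hle
    nlinarith [mul_nonneg hM hpos.le]
  have hsub : Icc (s + h / 6) (t - h / 6) ⊆ Ioo s t := fun z hz =>
    ⟨by linarith [hz.1], by linarith [hz.2]⟩
  obtain ⟨a₀, ha₀, ha₀le⟩ : ∃ a₀ > (0 : ℝ), ∀ z ∈ Icc (s + h / 6) (t - h / 6), a₀ ≤ a z := by
    obtain ⟨z, hz, hzmin⟩ := isCompact_Icc.exists_isMinOn
      (nonempty_Icc.2 (by linarith : s + h / 6 ≤ t - h / 6))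
      (ha.mono (hsub.trans Ioo_subset_Icc_self))
    exact ⟨a z, hapos z (hsub hz), fun y hy => hzmin hy⟩
  refine ⟨2 * (2 * (M + 8 / (h / 6) ^ 2) / a₀) ^ (p - 1)⁻¹, ?_⟩
  intro u u' u'' hu hu' hu'' hpos hode
  obtain ⟨x, hx, hxmax⟩ := isCompact_Icc.exists_isMaxOn (nonempty_Icc.2 hst.le) hu
  intro y hy
  refine le_trans (hxmax hy) ?_
  obtain hK0 | hK := (hpos x hx).eq_or_lt
  · rw [← hK0]
    positivity
  set K := u x with hKdef
  have hle : ∀ z ∈ Icc s t, u z ≤ K := fun z hz => hxmax hz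
  have hcurv : ∀ z ∈ Ioo s t, u'' z ≤ M * K := fun z hz => by
    have hz' := Ioo_subset_Icc_self hz
    have h1 := mul_le_mul_of_nonneg_left (hle z hz') hM
    have h2 : 0 ≤ a z * u z ^ p := mul_nonneg (hapos z hz).le (Real.rpow_nonneg (hpos z hz') p)
    linarith [hode z hz]
  obtain ⟨A, hA1, hA2, hAu⟩ : ∃ A, s + h / 6 ≤ A ∧ A + h / 6 ≤ t - h / 6 ∧
      ∀ z ∈ Icc A (A + h / 6), K / 2 ≤ u z := by
    obtain hxl | hxr := le_total x ((s + t) / 2)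
    · refine ⟨x + h / 6, by linarith [hx.1], by linarith, fun z hz => ?_⟩
      have hy' : x + h ∈ Icc s t := ⟨by linarith [hx.1], by linarith⟩
      have key := half_le_of_second_deriv_le (θ := (z - x) / h) hM hK.le hu hu' hu'' hcurv hx hy'
        rfl (hpos _ hy') (by simpa using hMh) (div_nonneg (by linarith [hz.1]) hh.le)
        (by rw [div_le_iff₀ hh]; linarith [hz.2])
      have e : x + (z - x) / h * (x + h - x) = z := by
        field_simp
        ring
      rwa [e] at key
    · refine ⟨x - h / 3, by linarith, by linarith [hx.2], fun z hz => ?_⟩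
      have hy' : x - h ∈ Icc s t := ⟨by linarith, by linarith [hx.2]⟩
      have key := half_le_of_second_deriv_le (θ := (x - z) / h) hM hK.le hu hu' hu'' hcurv hx hy'
        rfl (hpos _ hy') (by simpa using hMh) (div_nonneg (by linarith [hz.2]) hh.le)
        (by rw [div_le_iff₀ hh]; linarith [hz.1])
      have e : x + (x - z) / h * (x - h - x) = z := by
        field_simp
        ring
      rwa [e] at key
  have hAsub : Icc A (A + h / 6) ⊆ Icc (s + h / 6) (t - h / 6) := Icc_subset_Icc hA1 hA2
  have hAst : Ioo A (A + h / 6) ⊆ Ioo s t := Ioo_subset_Icc_self.trans (hAsub.trans hsub)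
  have hAcc : Icc A (A + h / 6) ⊆ Icc s t := hAsub.trans (hsub.trans Ioo_subset_Icc_self)
  have hbound : a₀ * (K / 2) ^ p - M * K ≤ 8 * K / (h / 6) ^ 2 := by
    have key := neg_second_deriv_bound_le (K := K) (C := M * K - a₀ * (K / 2) ^ p) (by positivity)
      (hu.mono hAcc) (fun z hz => hu' z (hAst hz)) (fun z hz => hu'' z (hAst hz))
      (fun z hz => ?_) (fun z hz => hpos z (hAcc hz)) (fun z hz => hle z (hAcc hz))
    · linarith
    · have hz' := Ioo_subset_Icc_self hz
      have h1 := mul_le_mul_of_nonneg_left (hle z (hAcc hz')) hM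
      have h2 : a₀ * (K / 2) ^ p ≤ a z * u z ^ p :=
        mul_le_mul (ha₀le z (hAsub hz'))
          (Real.rpow_le_rpow (by positivity) (hAu z hz') (by linarith)) (by positivity)
          (hapos z (hAst hz)).le
      linarith [hode z (hAst hz)]
  have hsplit : (K / 2) ^ p = (K / 2) ^ (p - 1) * (K / 2) := by
    rw [← Real.rpow_add_one (by positivity)]
    congr 1
    ring
  have hpow : (K / 2) ^ (p - 1) ≤ 2 * (M + 8 / (h / 6) ^ 2) / a₀ := by
    rw [le_div_iff₀ ha₀]
    refine le_of_mul_le_mul_right ?_ (half_pos hK)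
    have e : 2 * (M + 8 / (h / 6) ^ 2) * (K / 2) = M * K + 8 * K / (h / 6) ^ 2 := by ring
    rw [e]
    rw [hsplit] at hbound
    linarith
  have := (Real.le_rpow_inv_iff_of_pos (by positivity : 0 ≤ K / 2) (by positivity)
    (by linarith : 0 < p - 1)).2 hpow
  linarith

/-- A convex function is bounded on an interval by a common bound of its boundary values. -/
theorem le_of_second_deriv_nonneg {s t R : ℝ} {u u' u'' : ℝ → ℝ}
    (hu : ContinuousOn u (Icc s t))
    (hu' : ∀ x ∈ Ioo s t, HasDerivAt u (u' x) x)
    (hu'' : ∀ x ∈ Ioo s t, HasDerivAt u' (u'' x) x)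
    (hnn : ∀ x ∈ Ioo s t, 0 ≤ u'' x) (hs : u s ≤ R) (ht : u t ≤ R) :
    ∀ x ∈ Icc s t, u x ≤ R := by
  intro x hx
  have hconv : ConvexOn ℝ (Icc s t) u := by
    refine convexOn_of_hasDerivWithinAt2_nonneg (f' := u') (f'' := u'') (convex_Icc s t) hu
      ?_ ?_ ?_ <;> rw [interior_Icc]
    · exact fun x hx => (hu' x hx).hasDerivWithinAt
    · exact fun x hx => (hu'' x hx).hasDerivWithinAt
    · exact hnn
  have hst : s ≤ t := hx.1.trans hx.2
  exact (hconv.le_max_of_mem_Icc (left_mem_Icc.2 hst) (right_mem_Icc.2 hst) hx).trans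
    (max_le hs ht)

/-- The consecutive intervals `[τ i, σ (i + 1)]` and `[σ i, τ i]` cover `[τ 0, σ (n + 1)]`. -/
theorem exists_mem_Icc_of_mem_Icc {σ τ : ℕ → ℝ} {x : ℝ} (hx : τ 0 ≤ x) (n : ℕ)
    (hxn : x ≤ σ (n + 1)) :
    (∃ i ≤ n, x ∈ Icc (τ i) (σ (i + 1))) ∨ ∃ i, 1 ≤ i ∧ i ≤ n ∧ x ∈ Icc (σ i) (τ i) := by
  induction n with
  | zero => exact Or.inl ⟨0, le_rfl, hx, hxn⟩
  | succ k ih =>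
    by_cases h1 : τ (k + 1) ≤ x
    · exact Or.inl ⟨k + 1, le_rfl, h1, hxn⟩
    by_cases h2 : x ≤ σ (k + 1)
    · rcases ih h2 with ⟨i, hi, hxi⟩ | ⟨i, h1i, hi, hxi⟩
      · exact Or.inl ⟨i, by omega, hxi⟩
      · exact Or.inr ⟨i, h1i, by omega, hxi⟩
    · exact Or.inr ⟨k + 1, by omega, le_rfl, (not_le.1 h2).le, (not_le.1 h1).le⟩

theorem a_priori_bound_perturbed_problem
    (L p : ℝ) (hL : 0 < L) (hp : 1 < p)
    (a : ℝ → ℝ) (ha : ContinuousOn a (Icc 0 L))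
    (n : ℕ) (hn : 1 ≤ n) (σ τ : ℕ → ℝ)
    (hτ0 : τ 0 = 0) (hσlast : σ (n + 1) = L)
    (h0σ : τ 0 ≤ σ 1) (hτL : τ n ≤ σ (n + 1))
    (hστ : ∀ i, 1 ≤ i → i ≤ n → σ i < τ i)
    (hτσ : ∀ i, 1 ≤ i → i < n → τ i < σ (i + 1))
    (hapos : ∀ i, 1 ≤ i → i ≤ n → ∀ x ∈ Ioo (σ i) (τ i), 0 < a x)
    (haneg : ∀ i, i ≤ n → ∀ x ∈ Ioo (τ i) (σ (i + 1)), a x < 0)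
    (γ : ℕ → ℝ) (hγ : ∀ i, 1 ≤ i → i ≤ n → 0 < γ i)
    (hG : ∀ i, 1 ≤ i → i ≤ n → ∃ ρi : ℝ → ℝ,
      ContinuousOn ρi (Icc (σ i) (τ i)) ∧
      (∃ ε > (0:ℝ), ∃ c > (0:ℝ), ∀ x ∈ Icc (σ i) (τ i),
        (|x - σ i| < ε ∨ |x - τ i| < ε) → c ≤ |ρi x|) ∧
      (∀ x ∈ Ioo (σ i) (τ i), a x = ρi x * (min (x - σ i) (τ i - x)) ^ γ i))
    -- `𝓘`-admissible weight `w`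
    (I : Finset ℕ) (hI : I ⊆ Finset.Icc 1 n) (hIne : I.Nonempty)
    (w : ℝ → ℝ) (hwc : ContinuousOn w (Icc 0 L))
    (hwpos : ∀ i ∈ I, ∀ x ∈ Ioo (σ i) (τ i), 0 < w x)
    (hwzero : ∀ x ∈ Icc (0:ℝ) L, (∀ i ∈ I, x ∉ Icc (σ i) (τ i)) → w x = 0)
    (hwq : ∀ i ∈ I, ∃ qi : ℝ → ℝ,
      ContinuousOn qi (Icc (σ i) (τ i)) ∧
      (∃ ε > (0:ℝ), ∃ c > (0:ℝ), ∀ x ∈ Icc (σ i) (τ i),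
        (|x - σ i| < ε ∨ |x - τ i| < ε) → c ≤ |qi x|) ∧
      (∀ x ∈ Ioo (σ i) (τ i), w x = qi x * (min (x - σ i) (τ i - x)) ^ γ i))
    (lam : ℝ) (hlam : lam < 0) :
    ∃ R > (0:ℝ), ∀ μ : ℝ, 0 ≤ μ →
      ∀ u u' u'' : ℝ → ℝ,
        (∀ x ∈ Icc (0:ℝ) L, HasDerivWithinAt u (u' x) (Icc (0:ℝ) L) x) →
        (∀ x ∈ Icc (0:ℝ) L, HasDerivWithinAt u' (u'' x) (Icc (0:ℝ) L) x) →
        ContinuousOn u'' (Icc (0:ℝ) L) →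
        (∀ x ∈ Icc (0:ℝ) L, 0 ≤ u x) →
        u 0 = 0 → u L = 0 →
        (∀ x ∈ Ioo (0:ℝ) L, -u'' x = lam * u x + a x * u x ^ p + μ * w x) →
        supNorm u (Icc 0 L) < R := by
  have hτσ' : ∀ i ≤ n, τ i ≤ σ (i + 1) := by
    intro i hi
    obtain rfl | hi0 := Nat.eq_zero_or_pos i
    · exact h0σ
    obtain rfl | hin := hi.eq_or_lt
    · exact hτL
    · exact (hτσ i hi0 hin).le
  have hστ' : ∀ i, 1 ≤ i → i ≤ n → σ i ≤ τ i := fun i h1 h2 => (hστ i h1 h2).le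
  have hτmono : ∀ i j, i ≤ j → j ≤ n → τ i ≤ τ j := by
    intro i j hij
    induction j, hij using Nat.le_induction with
    | base => exact fun _ => le_rfl
    | succ k _ ih =>
      exact fun hk => (ih (by omega)).trans
        ((hτσ' k (by omega)).trans (hστ' (k + 1) (by omega) hk))
  have hσmono : ∀ i j, 1 ≤ i → i ≤ j → j ≤ n + 1 → σ i ≤ σ j := by
    intro i j hi hij
    induction j, hij using Nat.le_induction with
    | base => exact fun _ => le_rfl
    | succ k _ ih =>
      exact fun hk => (ih (by omega)).trans
        ((hστ' k (by omega) (by omega)).trans (hτσ' k (by omega)))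
  have hτmem : ∀ i ≤ n, τ i ∈ Icc 0 L := fun i hi =>
    ⟨hτ0 ▸ hτmono 0 i (Nat.zero_le i) hi, hσlast ▸ (hτmono i n hi le_rfl).trans hτL⟩
  have hσmem : ∀ i, 1 ≤ i → i ≤ n + 1 → σ i ∈ Icc 0 L := fun i h1 hi =>
    ⟨hτ0 ▸ h0σ.trans (hσmono 1 i le_rfl h1 hi), hσlast ▸ hσmono i (n + 1) h1 hi le_rfl⟩
  have hwplus : ∀ i, 1 ≤ i → i ≤ n → ∀ x ∈ Ioo (σ i) (τ i), 0 ≤ w x := by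
    intro i h1 hi x hx
    by_cases hiI : i ∈ I
    · exact (hwpos i hiI x hx).le
    refine (hwzero x ⟨(hσmem i h1 (by omega)).1.trans hx.1.le,
      hx.2.le.trans (hτmem i hi).2⟩ fun j hj hxj => ?_).ge
    have hjn := Finset.mem_Icc.1 (hI hj)
    rcases lt_trichotomy i j with hij | rfl | hij
    · linarith [hx.2, hxj.1, hτσ' i hi, hσmono (i + 1) j (by omega) hij (by omega)]
    · exact hiI hj
    · linarith [hx.1, hxj.2, hτσ' j hjn.2, hσmono (j + 1) i (by omega) hij (by omega)]
  have hwminus : ∀ i ≤ n, ∀ x ∈ Ioo (τ i) (σ (i + 1)), w x = 0 := by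
    intro i hi x hx
    refine hwzero x ⟨(hτmem i hi).1.trans hx.1.le,
      hx.2.le.trans (hσmem (i + 1) (by omega) (by omega)).2⟩ fun j hj hxj => ?_
    have hjn := Finset.mem_Icc.1 (hI hj)
    rcases le_or_gt j i with hji | hij
    · linarith [hx.1, hxj.2, hτmono j i hji hi]
    · linarith [hx.2, hxj.1, hσmono (i + 1) j (by omega) hij (by omega)]
  have hIccplus : ∀ i, 1 ≤ i → i ≤ n → Icc (σ i) (τ i) ⊆ Icc 0 L := fun i h1 hi =>
    Icc_subset_Icc (hσmem i h1 (by omega)).1 (hτmem i hi).2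
  have hIccminus : ∀ i ≤ n, Icc (τ i) (σ (i + 1)) ⊆ Icc 0 L := fun i hi =>
    Icc_subset_Icc (hτmem i hi).1 (hσmem (i + 1) (by omega) (by omega)).2
  have hIooplus : ∀ i, 1 ≤ i → i ≤ n → Ioo (σ i) (τ i) ⊆ Ioo 0 L := fun i h1 hi =>
    Ioo_subset_Ioo (hσmem i h1 (by omega)).1 (hτmem i hi).2
  have hIoominus : ∀ i ≤ n, Ioo (τ i) (σ (i + 1)) ⊆ Ioo 0 L := fun i hi =>
    Ioo_subset_Ioo (hτmem i hi).1 (hσmem (i + 1) (by omega) (by omega)).2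
  have hlocal := fun i (h1 : 1 ≤ i) (hi : i ≤ n) =>
    exists_bound_of_pos_coeff (hστ i h1 hi) (neg_nonneg.2 hlam.le) hp
      (ha.mono (hIccplus i h1 hi)) (hapos i h1 hi)
  choose! R hR using hlocal
  have hsum : 0 ≤ ∑ i ∈ Finset.Icc 1 n, |R i| := Finset.sum_nonneg fun i _ => abs_nonneg _
  refine ⟨∑ i ∈ Finset.Icc 1 n, |R i| + 1, by linarith, ?_⟩
  intro μ hμ u u' u'' hu hu' _ hunn hu0 huL hode
  have hcont : ContinuousOn u (Icc 0 L) := fun x hx => (hu x hx).continuousWithinAt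
  have hd : ∀ x ∈ Ioo 0 L, HasDerivAt u (u' x) x := fun x hx =>
    (hu x (Ioo_subset_Icc_self hx)).hasDerivAt (Icc_mem_nhds hx.1 hx.2)
  have hd' : ∀ x ∈ Ioo 0 L, HasDerivAt u' (u'' x) x := fun x hx =>
    (hu' x (Ioo_subset_Icc_self hx)).hasDerivAt (Icc_mem_nhds hx.1 hx.2)
  have hplus : ∀ i, 1 ≤ i → i ≤ n → ∀ x ∈ Icc (σ i) (τ i),
      u x ≤ ∑ i ∈ Finset.Icc 1 n, |R i| := by
    intro i h1 hi x hx
    have hRi : u x ≤ R i := by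
      refine hR i h1 hi u u' u'' (hcont.mono (hIccplus i h1 hi))
        (fun z hz => hd z (hIooplus i h1 hi hz)) (fun z hz => hd' z (hIooplus i h1 hi hz))
        (fun z hz => hunn z (hIccplus i h1 hi hz)) (fun z hz => ?_) x hx
      linarith [hode z (hIooplus i h1 hi hz), mul_nonneg hμ (hwplus i h1 hi z hz)]
    exact (hRi.trans (le_abs_self _)).trans
      (Finset.single_le_sum (f := fun i => |R i|) (fun j _ => abs_nonneg _)
        (Finset.mem_Icc.2 ⟨h1, hi⟩))
  have hτle : ∀ i ≤ n, u (τ i) ≤ ∑ i ∈ Finset.Icc 1 n, |R i| := by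
    intro i hi
    obtain rfl | hi0 := Nat.eq_zero_or_pos i
    · rwa [hτ0, hu0]
    · exact hplus i hi0 hi _ (right_mem_Icc.2 (hστ' i hi0 hi))
  have hσle : ∀ i ≤ n, u (σ (i + 1)) ≤ ∑ i ∈ Finset.Icc 1 n, |R i| := by
    intro i hi
    obtain rfl | hin := hi.eq_or_lt
    · rwa [hσlast, huL]
    · exact hplus (i + 1) (by omega) hin _ (left_mem_Icc.2 (hστ' (i + 1) (by omega) hin))
  have hbound : ∀ x ∈ Icc 0 L, u x ≤ ∑ i ∈ Finset.Icc 1 n, |R i| := by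
    intro x hx
    rcases exists_mem_Icc_of_mem_Icc (hτ0.le.trans hx.1) n (hx.2.trans hσlast.ge) with
      ⟨i, hi, hxi⟩ | ⟨i, h1, hi, hxi⟩
    · refine le_of_second_deriv_nonneg (hcont.mono (hIccminus i hi))
        (fun z hz => hd z (hIoominus i hi hz)) (fun z hz => hd' z (hIoominus i hi hz))
        (fun z hz => ?_) (hτle i hi) (hσle i hi) x hxi
      have hz0 := hIoominus i hi hz
      have huz := hunn z (Ioo_subset_Icc_self hz0)
      have h := hode z hz0
      rw [hwminus i hi z hz, mul_zero, add_zero] at h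
      linarith [mul_nonpos_of_nonpos_of_nonneg hlam.le huz,
        mul_nonpos_of_nonpos_of_nonneg (haneg i hi z hz).le (Real.rpow_nonneg huz p)]
    · exact hplus i h1 hi x hxi
  refine lt_of_le_of_lt (csSup_le ((nonempty_Icc.2 hL.le).image _) ?_) (lt_add_one _)
  rintro _ ⟨x, hx, rfl⟩
  simpa only [abs_of_nonneg (hunn x hx)] using hbound x hx
end

section
/- Assume hypotheses (Ha) and (G), let 𝓘 ⊆ {1,…,n} be nonempty, and let w ∈ C([0,L]) be 𝓘-admissible. Then for every λ < 0 there exists μ_* = μ_*(λ) > 0 such that for every μ ≥ μ_* there is no function u ∈ C²([0,L]) with u ≥ 0, u not identically zero, u(0) = u(L) = 0, and −u''(x) = λ u(x) + a(x) u(x)^p + μ w(x) for all x ∈ (0,L). -/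
open Set

/-- Sturm comparison with `sin (k (x - α))`: a nonnegative function cannot satisfy
`u'' + k² u < 0` throughout an interval of length `π / k`. -/
theorem false_of_deriv2_add_sq_mul_neg {u u' u'' : ℝ → ℝ} {α k : ℝ} (hk : 0 < k)
    (hu : ∀ x ∈ Icc α (α + Real.pi / k), HasDerivAt u (u' x) x)
    (hu' : ∀ x ∈ Icc α (α + Real.pi / k), HasDerivAt u' (u'' x) x)
    (hnonneg : ∀ x ∈ Icc α (α + Real.pi / k), 0 ≤ u x)
    (hneg : ∀ x ∈ Ioo α (α + Real.pi / k), u'' x + k ^ 2 * u x < 0) : False := by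
  set β := α + Real.pi / k with hβ
  have hαβ : α < β := by
    have := div_pos Real.pi_pos hk
    linarith
  have hkβ : k * (β - α) = Real.pi := by
    rw [hβ]
    field_simp
    ring
  have hlin (x : ℝ) : HasDerivAt (fun y => k * (y - α)) k x := by
    simpa using ((hasDerivAt_id x).sub_const α).const_mul k
  have hW : ∀ x ∈ Icc α β, HasDerivAt
      (fun y => u' y * Real.sin (k * (y - α)) - u y * (k * Real.cos (k * (y - α))))
      ((u'' x + k ^ 2 * u x) * Real.sin (k * (x - α))) x := by
    intro x hx
    exact (((hu' x hx).mul (hlin x).sin).sub ((hu x hx).mul ((hlin x).cos.const_mul k))).congr_deriv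
      (by ring)
  have hanti := strictAntiOn_of_deriv_neg (convex_Icc α β)
    (fun x hx => (hW x hx).continuousAt.continuousWithinAt) (by
      intro x hx
      rw [interior_Icc] at hx
      rw [(hW x (Ioo_subset_Icc_self hx)).deriv]
      refine mul_neg_of_neg_of_pos (hneg x hx) (Real.sin_pos_of_pos_of_lt_pi ?_ ?_)
      · exact mul_pos hk (sub_pos.2 hx.1)
      · rw [← hkβ]
        exact mul_lt_mul_of_pos_left (by linarith [hx.2]) hk)
  have h := hanti (left_mem_Icc.2 hαβ.le) (right_mem_Icc.2 hαβ.le) hαβ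
  simp only [hkβ, sub_self, mul_zero, Real.sin_zero, Real.cos_zero, Real.sin_pi,
    Real.cos_pi] at h
  have h₁ := mul_nonneg (hnonneg α (left_mem_Icc.2 hαβ.le)) hk.le
  have h₂ := mul_nonneg (hnonneg β (right_mem_Icc.2 hαβ.le)) hk.le
  linarith

/-- A superlinear power dominates any linear term up to a constant. -/
theorem exists_mul_le_mul_rpow_add {p c K : ℝ} (hp : 1 < p) (hc : 0 < c) (hK : 0 < K) :
    ∃ C > (0 : ℝ), ∀ v : ℝ, 0 ≤ v → K * v ≤ c * v ^ p + C := by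
  have hr : 0 < (K / c) ^ (p - 1)⁻¹ := Real.rpow_pos_of_pos (div_pos hK hc) _
  refine ⟨K * (K / c) ^ (p - 1)⁻¹, mul_pos hK hr, fun v hv => ?_⟩
  rcases le_total v ((K / c) ^ (p - 1)⁻¹) with h | h
  · have := mul_le_mul_of_nonneg_left h hK.le
    have := mul_nonneg hc.le (Real.rpow_nonneg hv p)
    linarith
  · have hv0 : 0 < v := hr.trans_le h
    have h1 : K / c ≤ v ^ (p - 1) := by
      calc K / c = ((K / c) ^ (p - 1)⁻¹) ^ (p - 1) :=
            (Real.rpow_inv_rpow (div_pos hK hc).le (by linarith)).symm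
        _ ≤ v ^ (p - 1) := Real.rpow_le_rpow hr.le h (by linarith)
    have h2 : v ^ p = v ^ (p - 1) * v := by
      rw [← Real.rpow_add_one hv0.ne', sub_add_cancel]
    have h3 : K ≤ c * v ^ (p - 1) := by
      rwa [div_le_iff₀' hc] at h1
    have := mul_le_mul_of_nonneg_right h3 hv
    have := mul_pos hK hr
    rw [h2]
    linarith

theorem exists_pos_le_of_continuousOn_Icc {f : ℝ → ℝ} {α β : ℝ} (hαβ : α ≤ β)
    (hf : ContinuousOn f (Icc α β)) (hpos : ∀ x ∈ Icc α β, 0 < f x) :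
    ∃ c > (0 : ℝ), ∀ x ∈ Icc α β, c ≤ f x := by
  obtain ⟨x, hx, hmin⟩ := isCompact_Icc.exists_isMinOn (nonempty_Icc.2 hαβ) hf
  exact ⟨f x, hpos x hx, fun y hy => hmin hy⟩

theorem nonexistence_for_large_mu
    (L p : ℝ) (hL : 0 < L) (hp : 1 < p)
    (a : ℝ → ℝ) (ha : ContinuousOn a (Icc 0 L))
    (n : ℕ) (hn : 1 ≤ n) (σ τ : ℕ → ℝ)
    (hτ0 : τ 0 = 0) (hσlast : σ (n + 1) = L)
    (h0σ : τ 0 ≤ σ 1) (hτL : τ n ≤ σ (n + 1))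
    (hστ : ∀ i, 1 ≤ i → i ≤ n → σ i < τ i)
    (hτσ : ∀ i, 1 ≤ i → i < n → τ i < σ (i + 1))
    (hapos : ∀ i, 1 ≤ i → i ≤ n → ∀ x ∈ Ioo (σ i) (τ i), 0 < a x)
    (haneg : ∀ i, i ≤ n → ∀ x ∈ Ioo (τ i) (σ (i + 1)), a x < 0)
    (γ : ℕ → ℝ) (hγ : ∀ i, 1 ≤ i → i ≤ n → 0 < γ i)
    (hG : ∀ i, 1 ≤ i → i ≤ n → ∃ ρi : ℝ → ℝ,
      ContinuousOn ρi (Icc (σ i) (τ i)) ∧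
      (∃ ε > (0:ℝ), ∃ c > (0:ℝ), ∀ x ∈ Icc (σ i) (τ i),
        (|x - σ i| < ε ∨ |x - τ i| < ε) → c ≤ |ρi x|) ∧
      (∀ x ∈ Ioo (σ i) (τ i), a x = ρi x * (min (x - σ i) (τ i - x)) ^ γ i))
    -- `𝓘`-admissible weight `w`
    (I : Finset ℕ) (hI : I ⊆ Finset.Icc 1 n) (hIne : I.Nonempty)
    (w : ℝ → ℝ) (hwc : ContinuousOn w (Icc 0 L))
    (hwpos : ∀ i ∈ I, ∀ x ∈ Ioo (σ i) (τ i), 0 < w x)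
    (hwzero : ∀ x ∈ Icc (0:ℝ) L, (∀ i ∈ I, x ∉ Icc (σ i) (τ i)) → w x = 0)
    (hwq : ∀ i ∈ I, ∃ qi : ℝ → ℝ,
      ContinuousOn qi (Icc (σ i) (τ i)) ∧
      (∃ ε > (0:ℝ), ∃ c > (0:ℝ), ∀ x ∈ Icc (σ i) (τ i),
        (|x - σ i| < ε ∨ |x - τ i| < ε) → c ≤ |qi x|) ∧
      (∀ x ∈ Ioo (σ i) (τ i), w x = qi x * (min (x - σ i) (τ i - x)) ^ γ i))
    (lam : ℝ) (hlam : lam < 0) :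
    ∃ μstar > (0:ℝ), ∀ μ : ℝ, μstar ≤ μ →
      ¬ ∃ u u' u'' : ℝ → ℝ,
        (∀ x ∈ Icc (0:ℝ) L, HasDerivWithinAt u (u' x) (Icc (0:ℝ) L) x) ∧
        (∀ x ∈ Icc (0:ℝ) L, HasDerivWithinAt u' (u'' x) (Icc (0:ℝ) L) x) ∧
        ContinuousOn u'' (Icc (0:ℝ) L) ∧
        (∀ x ∈ Icc (0:ℝ) L, 0 ≤ u x) ∧
        (∃ x ∈ Icc (0:ℝ) L, u x ≠ 0) ∧
        u 0 = 0 ∧ u L = 0 ∧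
        (∀ x ∈ Ioo (0:ℝ) L, -u'' x = lam * u x + a x * u x ^ p + μ * w x) := by
  obtain ⟨i, hi⟩ := hIne
  obtain ⟨hi1, hin⟩ := Finset.mem_Icc.1 (hI hi)
  have hσnonneg : ∀ j, 1 ≤ j → j ≤ n → 0 ≤ σ j := by
    intro j hj
    induction j, hj using Nat.le_induction with
    | base => intro _; linarith
    | succ j hj ih =>
      intro hjn
      linarith [ih (by omega), hστ j hj (by omega), hτσ j hj (by omega)]
  have hτle : ∀ k j, 1 ≤ j → j + k = n → τ j ≤ L := by
    intro k
    induction k with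
    | zero =>
      intro j _ hjn
      obtain rfl : j = n := by omega
      linarith
    | succ k ih =>
      intro j hj hjn
      linarith [ih (j + 1) (by omega) (by omega), hστ (j + 1) (by omega) (by omega),
        hτσ j hj (by omega)]
  have hs := hσnonneg i hi1 hin
  have ht := hτle (n - i) i hi1 (by omega)
  have hst := hστ i hi1 hin
  set α := (2 * σ i + τ i) / 3 with hα
  set k := 3 * Real.pi / (τ i - σ i) with hkdef
  have hd : 0 < τ i - σ i := sub_pos.2 hst
  have hk : 0 < k := div_pos (by linarith [Real.pi_pos]) hd
  have hβ : α + Real.pi / k = (σ i + 2 * τ i) / 3 := by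
    rw [hα, hkdef]
    field_simp
    ring
  have hsub : Icc α (α + Real.pi / k) ⊆ Ioo (σ i) (τ i) := by
    rw [hβ]
    exact fun x hx => ⟨by linarith [hx.1], by linarith [hx.2]⟩
  have hsub0 : Ioo (σ i) (τ i) ⊆ Ioo 0 L := Ioo_subset_Ioo hs ht
  have hsubL : Icc α (α + Real.pi / k) ⊆ Icc 0 L :=
    fun x hx => Ioo_subset_Icc_self (hsub0 (hsub hx))
  have hle : α ≤ α + Real.pi / k := by linarith [div_pos Real.pi_pos hk]
  obtain ⟨c, hc, hca⟩ := exists_pos_le_of_continuousOn_Icc hle (ha.mono hsubL)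
    (fun x hx => hapos i hi1 hin x (hsub hx))
  obtain ⟨d, hd0, hdw⟩ := exists_pos_le_of_continuousOn_Icc hle (hwc.mono hsubL)
    (fun x hx => hwpos i hi x (hsub hx))
  obtain ⟨C, hC, hCv⟩ := exists_mul_le_mul_rpow_add (K := k ^ 2 - lam) hp hc
    (by linarith [pow_pos hk 2])
  refine ⟨(C + 1) / d, by positivity, ?_⟩
  rintro μ hμ ⟨u, u', u'', hu, hu', -, hnonneg, -, -, -, heq⟩
  have hnhds : ∀ x ∈ Icc α (α + Real.pi / k), Icc 0 L ∈ nhds x :=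
    fun x hx => Icc_mem_nhds (hsub0 (hsub hx)).1 (hsub0 (hsub hx)).2
  refine false_of_deriv2_add_sq_mul_neg hk
    (fun x hx => (hu x (hsubL hx)).hasDerivAt (hnhds x hx))
    (fun x hx => (hu' x (hsubL hx)).hasDerivAt (hnhds x hx))
    (fun x hx => hnonneg x (hsubL hx)) fun x hx => ?_
  have hx := Ioo_subset_Icc_self hx
  have hux := hnonneg x (hsubL hx)
  have hμ0 : 0 ≤ μ := le_trans (by positivity) hμ
  have h1 : C + 1 ≤ μ * d := (div_le_iff₀ hd0).1 hμ
  have h2 := mul_le_mul_of_nonneg_left (hdw x hx) hμ0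
  have h3 := mul_le_mul_of_nonneg_right (hca x hx) (Real.rpow_nonneg hux p)
  linarith [heq x (hsub0 (hsub hx)), hCv (u x) hux]
end

section
/- Assume hypothesis (Ha). For any i ∈ {1,…,n}, any δ > 0, and any compact subinterval K ⊆ I_i^-, there exists λ̃ < 0 such that every nonnegative solution u of problem (P_λ) with λ < λ̃ satisfies sup_{x ∈ K} u(x) < δ. -/
open Set

/-- `u` is a nonnegative solution of problem (P_λ):
`u ∈ C²([0,L])`, `u ≥ 0`, `-u'' = λ u + a u^p` on `(0,L)`, `u(0) = u(L) = 0`. -/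
def IsNonnegSol (L p lam : ℝ) (a u : ℝ → ℝ) : Prop :=
  ∃ u' u'' : ℝ → ℝ,
    (∀ x ∈ Set.Icc (0:ℝ) L, HasDerivWithinAt u (u' x) (Set.Icc (0:ℝ) L) x) ∧
    (∀ x ∈ Set.Icc (0:ℝ) L, HasDerivWithinAt u' (u'' x) (Set.Icc (0:ℝ) L) x) ∧
    ContinuousOn u'' (Set.Icc (0:ℝ) L) ∧
    (∀ x ∈ Set.Icc (0:ℝ) L, 0 ≤ u x) ∧
    (∀ x ∈ Set.Ioo (0:ℝ) L, -u'' x = lam * u x + a x * u x ^ p) ∧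
    u 0 = 0 ∧ u L = 0

open Filter Topology

/-- Second-order necessary condition at a local maximum. -/
lemma IsLocalMax.hasDerivAt_hasDerivAt_nonpos {f g : ℝ → ℝ} {y s : ℝ} (hmax : IsLocalMax f y)
    (hf : ∀ᶠ x in 𝓝 y, HasDerivAt f (g x) x) (hg : HasDerivAt g s y) : s ≤ 0 := by
  by_contra! hs
  have hfg : deriv f =ᶠ[𝓝 y] g := hf.mono fun x hx => hx.deriv
  have hd : deriv (deriv f) y = s := by rw [hfg.deriv_eq, hg.deriv]
  have hmin : IsLocalMin f y :=
    isLocalMin_of_deriv_deriv_pos (hd ▸ hs) hmax.deriv_eq_zero hf.self_of_nhds.continuousAt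
  have hconst : f =ᶠ[𝓝 y] fun _ => f y := by
    filter_upwards [hmax, hmin] with x h₁ h₂ using le_antisymm h₁ h₂
  have hzero : deriv (deriv f) y = 0 := by
    rw [hconst.deriv.deriv_eq]
    simp
  linarith

/-- A maximum point of `u * ρ ^ (k + 2)`, where `ρ x = r ^ 2 - (x - x₀) ^ 2`, gives an upper
bound on `u''` in terms of `u`. -/
lemma secondDeriv_mul_sq_le_of_isLocalMax {u u' : ℝ → ℝ} {x₀ r y s : ℝ} (k : ℕ)
    (hy : 0 < r ^ 2 - (y - x₀) ^ 2)
    (hmax : IsLocalMax (fun x => u x * (r ^ 2 - (x - x₀) ^ 2) ^ (k + 2)) y)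
    (hu : ∀ᶠ x in 𝓝 y, HasDerivAt u (u' x) x) (hu' : HasDerivAt u' s y) (hu0 : 0 ≤ u y) :
    s * (r ^ 2 - (y - x₀) ^ 2) ^ 2
      ≤ u y * ((4 * (k + 2) * (k + 3) + 2 * (k + 2)) * r ^ 2) := by
  have hρ (x : ℝ) : HasDerivAt (fun x => r ^ 2 - (x - x₀) ^ 2) (-2 * (x - x₀)) x := by
    have h := (((hasDerivAt_id x).sub_const x₀).pow 2).const_sub (r ^ 2)
    refine h.congr_deriv ?_
    simp
  have hlin : HasDerivAt (fun x => -2 * (x - x₀)) (-2) y := by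
    simpa using ((hasDerivAt_id y).sub_const x₀).const_mul (-2)
  have hρp (j : ℕ) (x : ℝ) := (hρ x).pow (j + 1)
  have hfirst : ∀ᶠ x in 𝓝 y, HasDerivAt (fun x => u x * (r ^ 2 - (x - x₀) ^ 2) ^ (k + 2))
      (u' x * (r ^ 2 - (x - x₀) ^ 2) ^ (k + 2)
        + u x * ((k + 2) * ((r ^ 2 - (x - x₀) ^ 2) ^ (k + 1) * (-2 * (x - x₀))))) x := by
    filter_upwards [hu] with x hx
    refine (hx.mul (hρp (k + 1) x)).congr_deriv ?_
    simp only [Pi.pow_apply, Nat.add_sub_cancel]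
    push_cast
    ring
  have hsecond := (hu'.mul (hρp (k + 1) y)).add
    (hu.self_of_nhds.mul (((hρp k y).mul hlin).const_mul ((k : ℝ) + 2)))
  have hs := hmax.hasDerivAt_hasDerivAt_nonpos hfirst hsecond
  have h0 := hmax.hasDerivAt_eq_zero hfirst.self_of_nhds
  simp only [Pi.pow_apply, Pi.mul_apply, Nat.add_sub_cancel] at hs
  push_cast at hs
  have hrng : (y - x₀) ^ 2 ≤ r ^ 2 := by linarith
  have hρr : r ^ 2 - (y - x₀) ^ 2 ≤ r ^ 2 := by linarith [sq_nonneg (y - x₀)]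
  set ρ := r ^ 2 - (y - x₀) ^ 2 with hρdef
  set z := y - x₀
  have hk : (0 : ℝ) ≤ k := k.cast_nonneg
  have h1 : u' y * ρ = 2 * (k + 2) * z * u y := by
    have : ρ ^ (k + 1) * (u' y * ρ - 2 * (k + 2) * z * u y) = 0 := by
      rw [← h0]; ring
    rcases mul_eq_zero.mp this with h | h
    · exact absurd h (pow_pos hy _).ne'
    · linarith
  have h2 : s * ρ ^ 2 - 4 * (k + 2) * z * (u' y * ρ)
      + u y * (4 * (k + 2) * (k + 1) * z ^ 2 - 2 * (k + 2) * ρ) ≤ 0 := by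
    refine nonpos_of_mul_nonpos_right (a := ρ ^ k) ?_ (pow_pos hy k)
    refine le_trans (le_of_eq ?_) hs
    ring
  rw [h1] at h2
  have h3 : u y * (4 * (k + 2) * (k + 3) * z ^ 2 + 2 * (k + 2) * ρ)
      ≤ u y * ((4 * (k + 2) * (k + 3) + 2 * (k + 2)) * r ^ 2) := by
    refine mul_le_mul_of_nonneg_left ?_ hu0
    rw [add_mul]
    gcongr
  linarith

/-- For `m` large, nonnegative solutions of `u'' ≥ m u + α u ^ p` on an interval of radius `r`
are smaller than `δ` at its centre. -/
lemma exists_forall_center_lt_of_secondDeriv_ge {p α r δ : ℝ} (hp : 1 < p) (hα : 0 < α)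
    (hr : 0 < r) (hδ : 0 < δ) :
    ∃ M > 0, ∀ m > M, ∀ (x₀ : ℝ) (u u' u'' : ℝ → ℝ),
      (∀ x ∈ Icc (x₀ - r) (x₀ + r), HasDerivAt u (u' x) x) →
      (∀ x ∈ Icc (x₀ - r) (x₀ + r), HasDerivAt u' (u'' x) x) →
      (∀ x ∈ Icc (x₀ - r) (x₀ + r), 0 ≤ u x) →
      (∀ x ∈ Icc (x₀ - r) (x₀ + r), m * u x + α * u x ^ p ≤ u'' x) → u x₀ < δ := by
  obtain ⟨k, hk⟩ := exists_nat_gt (2 / (p - 1))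
  have hp1 : 0 < p - 1 := by linarith
  rw [div_lt_iff₀ hp1] at hk
  set ε := ((k + 2 : ℕ) : ℝ) * (p - 1) - 2 with hε
  have hεpos : 0 < ε := by
    rw [hε]; push_cast; nlinarith
  set C : ℝ := (4 * (k + 2) * (k + 3) + 2 * (k + 2)) * r ^ 2 with hC
  have hCpos : 0 < C := by positivity
  set A : ℝ := δ * (r ^ 2) ^ (k + 2) with hA
  have hApos : 0 < A := by positivity
  set B : ℝ := α * A ^ (p - 1) / C with hB
  have hBpos : 0 < B := by positivity
  refine ⟨C / (B ^ ε⁻¹) ^ 2, by positivity, ?_⟩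
  intro m hm x₀ u u' u'' hu hu' hu0 hode
  by_contra! hcontra
  set f : ℝ → ℝ := fun x => u x * (r ^ 2 - (x - x₀) ^ 2) ^ (k + 2) with hf
  have hfc : ContinuousOn f (Icc (x₀ - r) (x₀ + r)) := by
    have : ContinuousOn u (Icc (x₀ - r) (x₀ + r)) :=
      fun x hx => (hu x hx).continuousAt.continuousWithinAt
    fun_prop
  have hx₀ : x₀ ∈ Icc (x₀ - r) (x₀ + r) := ⟨by linarith, by linarith⟩
  obtain ⟨y, hy, hymax⟩ := isCompact_Icc.exists_isMaxOn ⟨x₀, hx₀⟩ hfc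
  have hAy : A ≤ f y := by
    refine le_trans ?_ (hymax hx₀)
    simp only [hf, hA, sub_self]
    norm_num
    gcongr
  have hρ0 : 0 ≤ r ^ 2 - (y - x₀) ^ 2 := by nlinarith [hy.1, hy.2]
  have hρ : 0 < r ^ 2 - (y - x₀) ^ 2 := by
    refine hρ0.lt_of_ne fun h => ?_
    have : f y = 0 := by simp [hf, ← h]
    linarith
  have hy' : y ∈ Ioo (x₀ - r) (x₀ + r) := by
    have := abs_lt_of_sq_lt_sq (sub_pos.mp hρ) hr.le
    rw [abs_lt] at this
    exact ⟨by linarith, by linarith⟩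
  have hnhds : Icc (x₀ - r) (x₀ + r) ∈ 𝓝 y := Icc_mem_nhds hy'.1 hy'.2
  have hbound := secondDeriv_mul_sq_le_of_isLocalMax k hρ (hymax.isLocalMax hnhds)
    (eventually_of_mem hnhds hu) (hu' y hy) (hu0 y hy)
  rw [← hC] at hbound
  set ρ := r ^ 2 - (y - x₀) ^ 2
  have huy : 0 < u y := by
    refine (hu0 y hy).lt_of_ne fun h => ?_
    have : f y = 0 := by simp [hf, ← h]
    linarith
  have hmpos : 0 < m := lt_trans (by positivity) hm
  have hpow : u y ^ p = u y * u y ^ (p - 1) := by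
    rw [← Real.rpow_one_add' huy.le (by linarith)]
    congr 1
    ring
  have hsum : m * ρ ^ 2 + α * u y ^ (p - 1) * ρ ^ 2 ≤ C := by
    refine le_of_mul_le_mul_left ?_ huy
    refine le_trans (le_of_eq ?_) ((mul_le_mul_of_nonneg_right (hode y hy)
      (sq_nonneg ρ)).trans hbound)
    rw [hpow]
    ring
  have hupow : 0 < u y ^ (p - 1) := Real.rpow_pos_of_pos huy _
  have hA' : A ^ (p - 1) ≤ u y ^ (p - 1) * (ρ ^ 2 * ρ ^ ε) := by
    have hρε : ρ ^ 2 * ρ ^ ε = (ρ ^ (k + 2)) ^ (p - 1) := by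
      rw [← Real.rpow_natCast ρ 2, ← Real.rpow_natCast ρ (k + 2), ← Real.rpow_mul hρ.le,
        ← Real.rpow_add hρ]
      congr 1
      rw [hε]
      push_cast
      ring
    rw [hρε, ← Real.mul_rpow huy.le (by positivity)]
    exact Real.rpow_le_rpow hApos.le hAy hp1.le
  have hBρ : B ≤ ρ ^ ε := by
    rw [hB, div_le_iff₀ hCpos]
    have hρεpos : 0 < ρ ^ ε := Real.rpow_pos_of_pos hρ _
    calc α * A ^ (p - 1) ≤ α * (u y ^ (p - 1) * (ρ ^ 2 * ρ ^ ε)) := by gcongr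
      _ = ρ ^ ε * (α * u y ^ (p - 1) * ρ ^ 2) := by ring
      _ ≤ ρ ^ ε * C := by
        gcongr
        have : 0 < m * ρ ^ 2 := by positivity
        linarith
  have hρB : B ^ ε⁻¹ ≤ ρ := by
    have h := Real.rpow_le_rpow hBpos.le hBρ (inv_pos.mpr hεpos).le
    rwa [Real.rpow_rpow_inv hρ.le hεpos.ne'] at h
  have hmC : C < m * (B ^ ε⁻¹) ^ 2 := (div_lt_iff₀ (by positivity)).mp hm
  have : m * (B ^ ε⁻¹) ^ 2 ≤ m * ρ ^ 2 := by gcongr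
  have : 0 < α * u y ^ (p - 1) * ρ ^ 2 := by positivity
  linarith

theorem smallness_in_negativity_intervals
    (L p : ℝ) (hL : 0 < L) (hp : 1 < p)
    (a : ℝ → ℝ) (ha : ContinuousOn a (Icc 0 L))
    (n : ℕ) (hn : 1 ≤ n) (σ τ : ℕ → ℝ)
    (hτ0 : τ 0 = 0) (hσlast : σ (n + 1) = L)
    (h0σ : τ 0 ≤ σ 1) (hτL : τ n ≤ σ (n + 1))
    (hστ : ∀ i, 1 ≤ i → i ≤ n → σ i < τ i)
    (hτσ : ∀ i, 1 ≤ i → i < n → τ i < σ (i + 1))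
    (hapos : ∀ i, 1 ≤ i → i ≤ n → ∀ x ∈ Ioo (σ i) (τ i), 0 < a x)
    (haneg : ∀ i, i ≤ n → ∀ x ∈ Ioo (τ i) (σ (i + 1)), a x < 0)
    (i : ℕ) (hi1 : 1 ≤ i) (hin : i ≤ n)
    (δ : ℝ) (hδ : 0 < δ)
    (c d : ℝ) (hcd : c ≤ d) (hc : τ i < c) (hd : d < σ (i + 1)) :
    ∃ ltil < (0:ℝ), ∀ lam < ltil, ∀ u : ℝ → ℝ,
      IsNonnegSol L p lam a u → ∀ x ∈ Icc c d, u x < δ := by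
  have hτ_nonneg : ∀ j ≤ n, 0 ≤ τ j := by
    intro j
    induction j with
    | zero => intro _; exact hτ0.ge
    | succ j ih =>
      intro hj
      have h1 := hστ (j + 1) (by omega) hj
      have h2 := ih (by omega)
      rcases Nat.eq_zero_or_pos j with rfl | hj0
      · linarith
      · linarith [hτσ j hj0 (by omega)]
  have hσ_le : ∀ j ≤ n, σ (j + 1) ≤ L := by
    intro j hj
    induction hj using Nat.decreasingInduction with
    | self => exact hσlast.le
    | of_succ j hj ih =>
      have h1 := hστ (j + 1) (by omega) (by omega)
      rcases Nat.lt_or_ge (j + 1) n with h | h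
      · linarith [hτσ (j + 1) (by omega) h]
      · obtain rfl : j + 1 = n := by omega
        linarith
  have hτi := hτ_nonneg i hin
  have hσi := hσ_le i hin
  obtain ⟨r, hr, hrc, hrd⟩ : ∃ r > 0, τ i < c - r ∧ d + r < σ (i + 1) := by
    refine ⟨min (c - τ i) (σ (i + 1) - d) / 2, ?_, ?_, ?_⟩
    · have : 0 < min (c - τ i) (σ (i + 1) - d) := lt_min (by linarith) (by linarith)
      linarith
    · linarith [min_le_left (c - τ i) (σ (i + 1) - d)]
    · linarith [min_le_right (c - τ i) (σ (i + 1) - d)]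
  have hsub : Icc (c - r) (d + r) ⊆ Ioo (τ i) (σ (i + 1)) :=
    fun x hx => ⟨by linarith [hx.1], by linarith [hx.2]⟩
  have hsub' : Ioo (τ i) (σ (i + 1)) ⊆ Ioo 0 L := Ioo_subset_Ioo hτi hσi
  obtain ⟨z, hz, hzmax⟩ := isCompact_Icc.exists_isMaxOn
    (nonempty_Icc.mpr (show c - r ≤ d + r by linarith))
    (ha.mono (hsub.trans (hsub'.trans Ioo_subset_Icc_self)))
  have hα : 0 < -a z := neg_pos.mpr (haneg i hin z (hsub hz))
  obtain ⟨M, hM, hMain⟩ := exists_forall_center_lt_of_secondDeriv_ge hp hα hr hδ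
  refine ⟨-M, by linarith, ?_⟩
  rintro lam hlam u ⟨u', u'', hu, hu', -, hu0, hode, -, -⟩ x hx
  have hball : Icc (x - r) (x + r) ⊆ Icc (c - r) (d + r) :=
    Icc_subset_Icc (by linarith [hx.1]) (by linarith [hx.2])
  have hint : ∀ y ∈ Icc (x - r) (x + r), y ∈ Ioo 0 L := fun y hy => hsub' (hsub (hball hy))
  refine hMain (-lam) (by linarith) x u u' u''
    (fun y hy => (hu y (Ioo_subset_Icc_self (hint y hy))).hasDerivAt
      (Icc_mem_nhds (hint y hy).1 (hint y hy).2))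
    (fun y hy => (hu' y (Ioo_subset_Icc_self (hint y hy))).hasDerivAt
      (Icc_mem_nhds (hint y hy).1 (hint y hy).2))
    (fun y hy => hu0 y (Ioo_subset_Icc_self (hint y hy))) ?_
  intro y hy
  have haz : a y ≤ a z := hzmax (hball hy)
  have hup : 0 ≤ u y ^ p := Real.rpow_nonneg (hu0 y (Ioo_subset_Icc_self (hint y hy))) p
  linarith [hode y (hint y hy), mul_le_mul_of_nonneg_right haz hup]
end

section
/- Assume hypothesis (Ha). For any ρ > 0 there exists λ̂(ρ) < 0 such that for every λ < λ̂(ρ) and every nonnegative solution u of problem (P_λ), one has sup_{x ∈ I_i^+} u(x) ≠ ρ for all i ∈ {1,…,n}. -/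
open Set

open Filter Topology

/-- Second-order lower bound to the right, from a lower bound on the second derivative. -/
theorem le_of_second_deriv_ge {x y s B : ℝ} {u u' u'' : ℝ → ℝ} (hxy : x ≤ y)
    (hu : ∀ t ∈ Icc x y, HasDerivWithinAt u (u' t) (Icc x y) t)
    (hu' : ∀ t ∈ Icc x y, HasDerivWithinAt u' (u'' t) (Icc x y) t)
    (hB : ∀ t ∈ Ioo x y, B ≤ u'' t) (hs : s ≤ u' x) :
    u x + s * (y - x) + B / 2 * (y - x) ^ 2 ≤ u y := by
  have h1 : MonotoneOn (fun t => u' t - B * (t - x)) (Icc x y) := by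
    have hd : ∀ t ∈ Icc x y,
        HasDerivWithinAt (fun t => u' t - B * (t - x)) (u'' t - B) (Icc x y) t := fun t ht => by
      simpa using (hu' t ht).fun_sub (((hasDerivWithinAt_id t _).sub_const x).const_mul B)
    refine monotoneOn_of_hasDerivWithinAt_nonneg (f' := fun t => u'' t - B) (convex_Icc x y)
      (fun t ht => (hd t ht).continuousWithinAt)
      (fun t ht => (hd t (interior_subset ht)).mono interior_subset) (fun t ht => ?_)
    rw [interior_Icc] at ht
    exact sub_nonneg.2 (hB t ht)
  have h2 : MonotoneOn (fun t => u t - s * (t - x) - B / 2 * (t - x) ^ 2) (Icc x y) := by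
    have hd : ∀ t ∈ Icc x y,
        HasDerivWithinAt (fun t => u t - s * (t - x) - B / 2 * (t - x) ^ 2)
          (u' t - s - B * (t - x)) (Icc x y) t := fun t ht => by
      have hid := (hasDerivWithinAt_id t (Icc x y)).sub_const x
      have := ((hu t ht).sub (hid.const_mul s)).sub ((hid.pow 2).const_mul (B / 2))
      refine this.congr_deriv ?_
      simp
      ring
    refine monotoneOn_of_hasDerivWithinAt_nonneg (f' := fun t => u' t - s - B * (t - x))
      (convex_Icc x y) (fun t ht => (hd t ht).continuousWithinAt)
      (fun t ht => (hd t (interior_subset ht)).mono interior_subset) (fun t ht => ?_)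
    have ht' := interior_subset ht
    have := h1 (left_mem_Icc.2 hxy) ht' ht'.1
    simp only [sub_self, mul_zero, sub_zero] at this
    linarith
  have := h2 (left_mem_Icc.2 hxy) (right_mem_Icc.2 hxy) hxy
  simp only [sub_self, mul_zero, sub_zero, ne_eq, OfNat.ofNat_ne_zero, not_false_eq_true,
    zero_pow] at this
  linarith

theorem HasDerivWithinAt.comp_neg_Icc {f : ℝ → ℝ} {f' x y t : ℝ}
    (h : HasDerivWithinAt f f' (Icc x y) (-t)) :
    HasDerivWithinAt (fun t => f (-t)) (-f') (Icc (-y) (-x)) t := by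
  have := HasDerivWithinAt.scomp (h := fun t : ℝ => -t) (h' := -1) t h
    (hasDerivWithinAt_neg t (Icc (-y) (-x)))
    (fun z hz => ⟨by linarith [hz.2], by linarith [hz.1]⟩)
  simpa [Function.comp_def] using this

/-- Second-order lower bound to the left, from a lower bound on the second derivative. -/
theorem le_of_second_deriv_ge_left {x y s B : ℝ} {u u' u'' : ℝ → ℝ} (hxy : x ≤ y)
    (hu : ∀ t ∈ Icc x y, HasDerivWithinAt u (u' t) (Icc x y) t)
    (hu' : ∀ t ∈ Icc x y, HasDerivWithinAt u' (u'' t) (Icc x y) t)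
    (hB : ∀ t ∈ Ioo x y, B ≤ u'' t) (hs : u' y ≤ -s) :
    u y + s * (y - x) + B / 2 * (y - x) ^ 2 ≤ u x := by
  have := le_of_second_deriv_ge (x := -y) (y := -x) (s := s) (B := B)
    (u := fun t => u (-t)) (u' := fun t => -u' (-t)) (u'' := fun t => u'' (-t)) (by linarith)
    (fun t ht => (hu (-t) ⟨by linarith [ht.2], by linarith [ht.1]⟩).comp_neg_Icc)
    (fun t ht => by
      simpa using (hu' (-t) ⟨by linarith [ht.2], by linarith [ht.1]⟩).comp_neg_Icc.fun_neg)
    (fun t ht => hB _ ⟨by linarith [ht.2], by linarith [ht.1]⟩) (by simp; linarith)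
  simp only [neg_neg] at this
  nlinarith

/-- One-sided Keller–Osserman bound for decreasing positive functions with `u'' ≥ α u ^ p`. -/
theorem exists_bound_of_second_deriv_ge_rpow {l r α p : ℝ} (hlr : l < r) (hα : 0 < α)
    (hp : 1 < p) :
    ∃ C > 0, ∀ u u' u'' : ℝ → ℝ,
      (∀ t ∈ Icc l r, HasDerivWithinAt u (u' t) (Icc l r) t) →
      (∀ t ∈ Icc l r, HasDerivWithinAt u' (u'' t) (Icc l r) t) →
      (∀ t ∈ Icc l r, 0 < u t) → (∀ t ∈ Icc l r, u' t ≤ 0) →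
      (∀ t ∈ Ioo l r, α * u t ^ p ≤ u'' t) → u r ≤ C := by
  obtain ⟨s, hs⟩ : ∃ s, s = (p - 1) / 2 := ⟨_, rfl⟩
  have hs0 : 0 < s := by linarith
  have hlim : Tendsto (fun C : ℝ => (1 + α * (C ^ s * (r - l)) ^ 2 / 8) ^ s) atTop atTop := by
    refine (tendsto_rpow_atTop hs0).comp (tendsto_atTop_add_const_left _ _ ?_)
    refine Tendsto.atTop_div_const (by norm_num) (Tendsto.const_mul_atTop hα ?_)
    exact (tendsto_pow_atTop two_ne_zero).comp
      ((tendsto_rpow_atTop hs0).atTop_mul_const (by linarith))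
  obtain ⟨C, hC2, hC0⟩ := ((hlim.eventually_gt_atTop 2).and (eventually_gt_atTop 0)).exists
  refine ⟨C, hC0, fun u u' u'' hu hu' hpos hneg hode => ?_⟩
  by_contra! hCr
  have hcont : ContinuousOn u (Icc l r) := fun t ht => (hu t ht).continuousWithinAt
  have hanti : AntitoneOn u (Icc l r) :=
    antitoneOn_of_hasDerivWithinAt_nonpos (convex_Icc l r) hcont
      (fun t ht => (hu t (interior_subset ht)).mono interior_subset)
      (fun t ht => hneg t (interior_subset ht))
  have hhc : ContinuousOn (fun t => u t ^ s * (t - l)) (Icc l r) :=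
    (hcont.rpow_const fun t _ => Or.inr hs0.le).mul (by fun_prop)
  obtain ⟨x, hx, hmax⟩ := isCompact_Icc.exists_isMaxOn ⟨r, right_mem_Icc.2 hlr.le⟩ hhc
  have hxr : u r ^ s * (r - l) ≤ u x ^ s * (x - l) := hmax (right_mem_Icc.2 hlr.le)
  have hCs : C ^ s * (r - l) ≤ u x ^ s * (x - l) :=
    (mul_le_mul_of_nonneg_right (Real.rpow_le_rpow hC0.le hCr.le hs0.le) (by linarith)).trans hxr
  have hCpos : 0 < C ^ s * (r - l) := mul_pos (Real.rpow_pos_of_pos hC0 s) (by linarith)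
  have hux := hpos x hx
  have huxs : 0 < u x ^ s := Real.rpow_pos_of_pos hux s
  have hxl : 0 < x - l := by
    by_contra! h
    nlinarith
  have hyI : (x + l) / 2 ∈ Icc l r := ⟨by linarith, by linarith [hx.2]⟩
  have hsub : Icc ((x + l) / 2) x ⊆ Icc l r := Icc_subset_Icc hyI.1 hx.2
  have htay := le_of_second_deriv_ge_left (x := (x + l) / 2) (y := x) (s := 0)
    (B := α * u x ^ p) (by linarith) (fun t ht => (hu t (hsub ht)).mono hsub)
    (fun t ht => (hu' t (hsub ht)).mono hsub)
    (fun t ht => by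
      refine le_trans ?_ (hode t ⟨by linarith [ht.1], by linarith [ht.2, hx.2]⟩)
      have := hanti (hsub ⟨ht.1.le, ht.2.le⟩) hx ht.2.le
      gcongr)
    (by simpa using hneg x hx)
  have hup : u x ^ p = u x * (u x ^ s) ^ 2 := by
    rw [← Real.rpow_natCast, ← Real.rpow_mul hux.le, mul_comm (u x), ← Real.rpow_add_one hux.ne']
    congr 1
    push_cast
    linarith
  have hgrow : u x * (1 + α * (C ^ s * (r - l)) ^ 2 / 8) ≤ u ((x + l) / 2) := by
    have hsq : (C ^ s * (r - l)) ^ 2 ≤ (u x ^ s * (x - l)) ^ 2 := by gcongr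
    calc u x * (1 + α * (C ^ s * (r - l)) ^ 2 / 8)
        ≤ u x * (1 + α * (u x ^ s * (x - l)) ^ 2 / 8) := by gcongr
      _ = u x + 0 * (x - (x + l) / 2) + α * u x ^ p / 2 * (x - (x + l) / 2) ^ 2 := by
          rw [hup]; ring
      _ ≤ _ := htay
  have hle : u ((x + l) / 2) ^ s * ((x + l) / 2 - l) ≤ u x ^ s * (x - l) := hmax hyI
  have hbig : u x ^ s * (1 + α * (C ^ s * (r - l)) ^ 2 / 8) ^ s ≤ u ((x + l) / 2) ^ s := by
    rw [← Real.mul_rpow hux.le (by positivity)]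
    exact Real.rpow_le_rpow (by positivity) hgrow hs0.le
  have h2 : u x ^ s * 2 < u ((x + l) / 2) ^ s :=
    (mul_lt_mul_of_pos_left hC2 huxs).trans_le hbig
  nlinarith

/-- If `u` is bounded by `ρ` then the linear term dominates for very negative `lam`. -/
theorem mul_le_of_ode {A κ ρ p lam v w b : ℝ} (hp : 1 < p) (hA : 0 ≤ A) (hb : b ≤ A)
    (hlam : lam ≤ -(A * ρ ^ (p - 1) + κ)) (hv0 : 0 ≤ v) (hvρ : v ≤ ρ)
    (h : -w = lam * v + b * v ^ p) : κ * v ≤ w := by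
  have h1 : v ^ p = v ^ (p - 1) * v := by
    rw [← Real.rpow_add_one' hv0 (by linarith)]
    congr 1
    ring
  have h2 : v ^ (p - 1) ≤ ρ ^ (p - 1) := Real.rpow_le_rpow hv0 hvρ (by linarith)
  have h3 : b * v ^ p ≤ A * ρ ^ (p - 1) * v := by
    rw [h1, mul_assoc]
    exact mul_le_mul hb (mul_le_mul_of_nonneg_right h2 hv0)
      (mul_nonneg (Real.rpow_nonneg hv0 _) hv0) hA
  nlinarith

/-- For very negative `lam`, a solution bounded by `ρ` on `[d, e]` does not take the value `ρ`
at `d`, when the weight is negative to the left of `d`. -/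
theorem eventually_left_endpoint_ne {c d e p ρ : ℝ} {a : ℝ → ℝ} (hcd : c < d) (hde : d < e)
    (hp : 1 < p) (hρ : 0 < ρ) (ha : ContinuousOn a (Icc c e)) (haneg : ∀ x ∈ Ioo c d, a x < 0) :
    ∀ᶠ lam : ℝ in atBot, ∀ u u' u'' : ℝ → ℝ,
      (∀ x ∈ Icc c e, HasDerivWithinAt u (u' x) (Icc c e) x) →
      (∀ x ∈ Icc c e, HasDerivWithinAt u' (u'' x) (Icc c e) x) →
      (∀ x ∈ Icc c e, 0 ≤ u x) →
      (∀ x ∈ Ioo c e, -u'' x = lam * u x + a x * u x ^ p) →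
      (∀ x ∈ Icc d e, u x ≤ ρ) → u d ≠ ρ := by
  obtain ⟨A₀, hA₀⟩ := isCompact_Icc.bddAbove_image ha
  obtain ⟨A, hA0, hA⟩ : ∃ A, 0 ≤ A ∧ ∀ x ∈ Icc c e, a x ≤ A :=
    ⟨max A₀ 0, le_max_right _ _, fun x hx => (hA₀ (mem_image_of_mem a hx)).trans (le_max_left _ _)⟩
  obtain ⟨l, hcl, hld⟩ := exists_between hcd
  obtain ⟨r, hlr, hrd⟩ := exists_between hld
  have hlr_sub : Icc l r ⊆ Icc c e := Icc_subset_Icc hcl.le (hrd.trans hde).le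
  obtain ⟨z, hz, hzmax⟩ := isCompact_Icc.exists_isMaxOn ⟨r, right_mem_Icc.2 hlr.le⟩
    (ha.mono hlr_sub)
  have hα : 0 < -a z := neg_pos.2 (haneg z ⟨hcl.trans_le hz.1, hz.2.trans_lt hrd⟩)
  obtain ⟨C, hC0, hC⟩ := exists_bound_of_second_deriv_ge_rpow hlr hα hp
  obtain ⟨K, hK⟩ : ∃ K, K = C / (d - r) := ⟨_, rfl⟩
  have hdr : 0 < d - r := by linarith
  have hK0 : 0 < K := hK ▸ div_pos hC0 hdr
  have hKC : K * (d - r) = C := by rw [hK]; field_simp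
  obtain ⟨δ, hδ⟩ : ∃ δ, δ = min (ρ / (2 * K)) (e - d) := ⟨_, rfl⟩
  have hδ0 : 0 < δ := hδ ▸ lt_min (by positivity) (by linarith)
  have hδK : K * δ ≤ ρ / 2 := by
    have : δ ≤ ρ / (2 * K) := hδ ▸ min_le_left _ _
    calc K * δ ≤ K * (ρ / (2 * K)) := by gcongr
      _ = ρ / 2 := by field_simp
  have hδe : d + δ ≤ e := by
    have : δ ≤ e - d := hδ ▸ min_le_right _ _
    linarith
  obtain ⟨κ, hκ⟩ : ∃ κ, κ = 4 * K / (ρ * δ) + 1 := ⟨_, rfl⟩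
  have hκ0 : 0 < κ := by rw [hκ]; positivity
  have hκK : K < κ * ρ * δ / 4 := by
    have : κ * ρ * δ / 4 = K + ρ * δ / 4 := by rw [hκ]; field_simp
    rw [this]
    have := mul_pos hρ hδ0
    linarith
  filter_upwards [eventually_le_atBot (-(A * ρ ^ (p - 1) + κ)), eventually_lt_atBot 0]
    with lam hlam hlam0 u u' u'' hu hu' hu0 hode huρ hud
  have hde_sub : Icc d e ⊆ Icc c e := Icc_subset_Icc_left hcd.le
  have hcd_sub : Icc c d ⊆ Icc c e := Icc_subset_Icc_right hde.le
  have hconv : ∀ x ∈ Ioo d e, κ * u x ≤ u'' x := fun x hx => by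
    have hx' := hde_sub (Ioo_subset_Icc_self hx)
    exact mul_le_of_ode hp hA0 (hA x hx') hlam (hu0 x hx')
      (huρ x (Ioo_subset_Icc_self hx)) (hode x ⟨hcd.trans hx.1, hx.2⟩)
  have hslope : u' d ≤ -K := by
    by_contra! hslope
    have hlow : ∀ x ∈ Icc d (d + δ), ρ / 2 ≤ u x := fun x hx => by
      have hsub : Icc d x ⊆ Icc c e := Icc_subset_Icc hcd.le (hx.2.trans hδe)
      have := le_of_second_deriv_ge (B := 0) hx.1 (fun t ht => (hu t (hsub ht)).mono hsub)
        (fun t ht => (hu' t (hsub ht)).mono hsub)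
        (fun t ht => (mul_nonneg hκ0.le (hu0 t (hsub ⟨ht.1.le, ht.2.le⟩))).trans
          (hconv t ⟨ht.1, ht.2.trans_le (hx.2.trans hδe)⟩)) hslope.le
      have h2 : K * (x - d) ≤ K * δ := by
        have := hx.2
        gcongr
        linarith
      rw [hud] at this
      linarith
    have hsub : Icc d (d + δ) ⊆ Icc c e := Icc_subset_Icc hcd.le hδe
    have h1 := le_of_second_deriv_ge (B := κ * (ρ / 2)) (by linarith : d ≤ d + δ)
      (fun t ht => (hu t (hsub ht)).mono hsub) (fun t ht => (hu' t (hsub ht)).mono hsub)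
      (fun t ht => (mul_le_mul_of_nonneg_left (hlow t ⟨ht.1.le, ht.2.le⟩) hκ0.le).trans
        (hconv t ⟨ht.1, ht.2.trans_le hδe⟩)) hslope.le
    have h2 := huρ (d + δ) ⟨by linarith, hδe⟩
    rw [hud] at h1
    have h3 := mul_lt_mul_of_pos_right hκK hδ0
    nlinarith
  have hup : ∀ x ∈ Ioo c d, -a x * u x ^ p ≤ u'' x := fun x hx => by
    have h1 := hode x ⟨hx.1, hx.2.trans hde⟩
    have h2 := hu0 x (hcd_sub (Ioo_subset_Icc_self hx))
    nlinarith
  have hmono : MonotoneOn u' (Icc c d) := by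
    refine monotoneOn_of_hasDerivWithinAt_nonneg (f' := u'') (convex_Icc c d)
      (fun t ht => ((hu' t (hcd_sub ht)).mono hcd_sub).continuousWithinAt)
      (fun t ht => (hu' t (hcd_sub (interior_subset ht))).mono
        (interior_subset.trans hcd_sub)) (fun t ht => ?_)
    rw [interior_Icc] at ht
    exact (mul_nonneg (neg_nonneg.2 (haneg t ht).le) (Real.rpow_nonneg
      (hu0 t (hcd_sub (Ioo_subset_Icc_self ht))) _)).trans (hup t ht)
  have hgrow : ∀ x ∈ Icc c d, ρ + K * (d - x) ≤ u x := fun x hx => by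
    have hsub : Icc x d ⊆ Icc c e := Icc_subset_Icc hx.1 hde.le
    have := le_of_second_deriv_ge_left (B := 0) hx.2 (fun t ht => (hu t (hsub ht)).mono hsub)
      (fun t ht => (hu' t (hsub ht)).mono hsub)
      (fun t ht => (mul_nonneg (neg_nonneg.2 (haneg t ⟨hx.1.trans_lt ht.1, ht.2⟩).le)
        (Real.rpow_nonneg (hu0 t (hsub ⟨ht.1.le, ht.2.le⟩)) _)).trans
          (hup t ⟨hx.1.trans_lt ht.1, ht.2⟩)) hslope
    rw [hud] at this
    linarith
  have hlrcd : Icc l r ⊆ Icc c d := Icc_subset_Icc hcl.le hrd.le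
  have hbound := hC u u' u'' (fun t ht => (hu t (hlr_sub ht)).mono hlr_sub)
    (fun t ht => (hu' t (hlr_sub ht)).mono hlr_sub)
    (fun t ht => by
      have h1 := hgrow t (hlrcd ht)
      have h2 := mul_nonneg hK0.le (sub_nonneg.2 (hlrcd ht).2)
      linarith)
    (fun t ht => by
      have := hmono (hlrcd ht) (right_mem_Icc.2 hcd.le) (hlrcd ht).2
      linarith)
    (fun t ht => by
      refine le_trans ?_ (hup t ⟨hcl.trans ht.1, ht.2.trans hrd⟩)
      have h1 : a t ≤ a z := hzmax (Ioo_subset_Icc_self ht)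
      exact mul_le_mul_of_nonneg_right (neg_le_neg h1)
        (Real.rpow_nonneg (hu0 t (hlr_sub (Ioo_subset_Icc_self ht))) _))
  have := hgrow r ⟨(hcl.trans hlr).le, hrd.le⟩
  linarith

/-- Mirror image of `eventually_left_endpoint_ne`. -/
theorem eventually_right_endpoint_ne {c d e p ρ : ℝ} {a : ℝ → ℝ} (hcd : c < d) (hde : d < e)
    (hp : 1 < p) (hρ : 0 < ρ) (ha : ContinuousOn a (Icc c e)) (haneg : ∀ x ∈ Ioo d e, a x < 0) :
    ∀ᶠ lam : ℝ in atBot, ∀ u u' u'' : ℝ → ℝ,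
      (∀ x ∈ Icc c e, HasDerivWithinAt u (u' x) (Icc c e) x) →
      (∀ x ∈ Icc c e, HasDerivWithinAt u' (u'' x) (Icc c e) x) →
      (∀ x ∈ Icc c e, 0 ≤ u x) →
      (∀ x ∈ Ioo c e, -u'' x = lam * u x + a x * u x ^ p) →
      (∀ x ∈ Icc c d, u x ≤ ρ) → u d ≠ ρ := by
  have hIcc : ∀ {x y t : ℝ}, t ∈ Icc (-y) (-x) → -t ∈ Icc x y :=
    fun ht => ⟨by linarith [ht.2], by linarith [ht.1]⟩
  have hIoo : ∀ {x y t : ℝ}, t ∈ Ioo (-y) (-x) → -t ∈ Ioo x y :=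
    fun ht => ⟨by linarith [ht.2], by linarith [ht.1]⟩
  filter_upwards [eventually_left_endpoint_ne (a := fun x => a (-x)) (neg_lt_neg hde)
    (neg_lt_neg hcd) hp hρ (ha.comp continuousOn_neg fun _ => hIcc)
    (fun x hx => haneg _ (hIoo hx))] with lam hlam u u' u'' hu hu' hu0 hode huρ
  have := hlam (fun x => u (-x)) (fun x => -u' (-x)) (fun x => u'' (-x))
    (fun x hx => (hu _ (hIcc hx)).comp_neg_Icc)
    (fun x hx => by simpa using (hu' _ (hIcc hx)).comp_neg_Icc.fun_neg)
    (fun x hx => hu0 _ (hIcc hx)) (fun x hx => hode _ (hIoo hx)) (fun x hx => huρ _ (hIcc hx))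
  simpa using this

/-- For very negative `lam`, a solution whose supremum over `(s, t)` is `ρ` is bounded by `ρ` on
`[s, t]` and takes the value `ρ` at one of the endpoints. -/
theorem eventually_endpoint_eq {L s t p ρ : ℝ} {a : ℝ → ℝ} (hs : 0 ≤ s) (hst : s < t)
    (ht : t ≤ L) (hp : 1 < p) (ha : ContinuousOn a (Icc 0 L)) :
    ∀ᶠ lam : ℝ in atBot, ∀ u : ℝ → ℝ, IsNonnegSol L p lam a u → sSup (u '' Ioo s t) = ρ →
      (∀ x ∈ Icc s t, u x ≤ ρ) ∧ (u s = ρ ∨ u t = ρ) := by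
  obtain ⟨A₀, hA₀⟩ := isCompact_Icc.bddAbove_image ha
  obtain ⟨A, hA0, hA⟩ : ∃ A, 0 ≤ A ∧ ∀ x ∈ Icc 0 L, a x ≤ A :=
    ⟨max A₀ 0, le_max_right _ _, fun x hx => (hA₀ (mem_image_of_mem a hx)).trans (le_max_left _ _)⟩
  filter_upwards [eventually_le_atBot (-(A * ρ ^ (p - 1) + 0))] with lam hlam u hu hsup
  obtain ⟨u', u'', hd, hd', -, hu0, hode, -, -⟩ := hu
  have hsub : Icc s t ⊆ Icc 0 L := Icc_subset_Icc hs ht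
  have hcont : ContinuousOn u (Icc s t) :=
    fun x hx => ((hd x (hsub hx)).mono hsub).continuousWithinAt
  have hbdd : BddAbove (u '' Ioo s t) :=
    (isCompact_Icc.bddAbove_image hcont).mono (image_mono Ioo_subset_Icc_self)
  have hle : ∀ x ∈ Icc s t, u x ≤ ρ := by
    have h1 : ∀ x ∈ Ioo s t, u x ≤ ρ := fun x hx => hsup ▸ le_csSup hbdd (mem_image_of_mem u hx)
    intro x hx
    rw [← closure_Ioo hst.ne] at hx hcont
    exact le_on_closure h1 hcont continuousOn_const hx
  refine ⟨hle, ?_⟩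
  obtain ⟨x, hx, hmax⟩ := isCompact_Icc.exists_isMaxOn ⟨s, left_mem_Icc.2 hst.le⟩ hcont
  have hρx : ρ ≤ u x := by
    rw [← hsup]
    refine csSup_le ((nonempty_Ioo.2 hst).image u) ?_
    rintro _ ⟨y, hy, rfl⟩
    exact hmax (Ioo_subset_Icc_self hy)
  have hconv : ∀ y ∈ Ioo s t, 0 ≤ u'' y := fun y hy => by
    have hy' := hsub (Ioo_subset_Icc_self hy)
    have := mul_le_of_ode hp hA0 (hA y hy') hlam (hu0 y hy') (hle y (Ioo_subset_Icc_self hy))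
      (hode y ⟨hs.trans_lt hy.1, hy.2.trans_le ht⟩)
    simpa using this
  rcases le_total (u' x) 0 with h | h
  · left
    have hsx : Icc s x ⊆ Icc 0 L := Icc_subset_Icc hs (hx.2.trans ht)
    have := le_of_second_deriv_ge_left (s := 0) (B := 0) hx.1
      (fun y hy => (hd y (hsx hy)).mono hsx) (fun y hy => (hd' y (hsx hy)).mono hsx)
      (fun y hy => hconv y ⟨hy.1, hy.2.trans_le hx.2⟩) (by simpa using h)
    exact le_antisymm (hle s (left_mem_Icc.2 hst.le)) (by linarith)
  · right
    have hxt : Icc x t ⊆ Icc 0 L := Icc_subset_Icc (hs.trans hx.1) ht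
    have := le_of_second_deriv_ge (B := 0) hx.2
      (fun y hy => (hd y (hxt hy)).mono hxt) (fun y hy => (hd' y (hxt hy)).mono hxt)
      (fun y hy => hconv y ⟨hx.1.trans_lt hy.1, hy.2⟩) h
    exact le_antisymm (hle t (right_mem_Icc.2 hst.le)) (by linarith)

/-- A positivity interval `(d, e)` inside `[0, L]` whose neighbours `(c, d)` and `(e, f)` are
either intervals of negativity or empty at the boundary of `[0, L]`. -/
theorem eventually_sSup_ne {L c d e f p ρ : ℝ} {a : ℝ → ℝ} (hc : 0 ≤ c) (hcd : c ≤ d)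
    (hde : d < e) (hef : e ≤ f) (hf : f ≤ L) (hd0 : c = d → d = 0) (heL : e = f → e = L)
    (hp : 1 < p) (hρ : 0 < ρ) (ha : ContinuousOn a (Icc 0 L))
    (hcneg : ∀ x ∈ Ioo c d, a x < 0) (hfneg : ∀ x ∈ Ioo e f, a x < 0) :
    ∀ᶠ lam : ℝ in atBot, ∀ u : ℝ → ℝ, IsNonnegSol L p lam a u → sSup (u '' Ioo d e) ≠ ρ := by
  have hce : Icc c e ⊆ Icc 0 L := Icc_subset_Icc hc (hef.trans hf)
  have hdf : Icc d f ⊆ Icc 0 L := Icc_subset_Icc (hc.trans hcd) hf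
  have hleft : ∀ᶠ lam : ℝ in atBot, ∀ u : ℝ → ℝ, IsNonnegSol L p lam a u →
      (∀ x ∈ Icc d e, u x ≤ ρ) → u d ≠ ρ := by
    rcases hcd.eq_or_lt with h | h
    · refine Eventually.of_forall ?_
      rintro lam u ⟨_, _, -, -, -, -, -, hu0, -⟩ -
      rw [hd0 h, hu0]
      exact hρ.ne
    · filter_upwards [eventually_left_endpoint_ne h hde hp hρ (ha.mono hce) hcneg] with lam hlam
      rintro u ⟨u', u'', hu, hu', -, hnn, hode, -, -⟩
      exact hlam u u' u'' (fun x hx => (hu x (hce hx)).mono hce)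
        (fun x hx => (hu' x (hce hx)).mono hce) (fun x hx => hnn x (hce hx))
        (fun x hx => hode x ⟨hc.trans_lt hx.1, hx.2.trans_le (hef.trans hf)⟩)
  have hright : ∀ᶠ lam : ℝ in atBot, ∀ u : ℝ → ℝ, IsNonnegSol L p lam a u →
      (∀ x ∈ Icc d e, u x ≤ ρ) → u e ≠ ρ := by
    rcases hef.eq_or_lt with h | h
    · refine Eventually.of_forall ?_
      rintro lam u ⟨_, _, -, -, -, -, -, -, huL⟩ -
      rw [heL h, huL]
      exact hρ.ne
    · filter_upwards [eventually_right_endpoint_ne hde h hp hρ (ha.mono hdf) hfneg] with lam hlam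
      rintro u ⟨u', u'', hu, hu', -, hnn, hode, -, -⟩
      exact hlam u u' u'' (fun x hx => (hu x (hdf hx)).mono hdf)
        (fun x hx => (hu' x (hdf hx)).mono hdf) (fun x hx => hnn x (hdf hx))
        (fun x hx => hode x ⟨(hc.trans hcd).trans_lt hx.1, hx.2.trans_le hf⟩)
  filter_upwards [hleft, hright,
    eventually_endpoint_eq (ρ := ρ) (hc.trans hcd) hde (hef.trans hf) hp ha]
    with lam hl hr hend u hu hsup
  obtain ⟨hle, h | h⟩ := hend u hu hsup
  · exact hl u hu hle h
  · exact hr u hu hle h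

theorem sup_on_positivity_intervals_avoids_rho
    (L p : ℝ) (hL : 0 < L) (hp : 1 < p)
    (a : ℝ → ℝ) (ha : ContinuousOn a (Icc 0 L))
    (n : ℕ) (hn : 1 ≤ n) (σ τ : ℕ → ℝ)
    (hτ0 : τ 0 = 0) (hσlast : σ (n + 1) = L)
    (h0σ : τ 0 ≤ σ 1) (hτL : τ n ≤ σ (n + 1))
    (hστ : ∀ i, 1 ≤ i → i ≤ n → σ i < τ i)
    (hτσ : ∀ i, 1 ≤ i → i < n → τ i < σ (i + 1))
    (hapos : ∀ i, 1 ≤ i → i ≤ n → ∀ x ∈ Ioo (σ i) (τ i), 0 < a x)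
    (haneg : ∀ i, i ≤ n → ∀ x ∈ Ioo (τ i) (σ (i + 1)), a x < 0)
    (ρ : ℝ) (hρ : 0 < ρ) :
    ∃ lhat < (0:ℝ), ∀ lam < lhat, ∀ u : ℝ → ℝ,
      IsNonnegSol L p lam a u →
      ∀ i, 1 ≤ i → i ≤ n → sSup (u '' Ioo (σ i) (τ i)) ≠ ρ := by
  have hstep : ∀ j ≤ n, τ j ≤ σ (j + 1) := fun j hj => by
    rcases Nat.eq_zero_or_pos j with rfl | hj0
    · exact h0σ
    · rcases hj.eq_or_lt with rfl | hjn
      · exact hτL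
      · exact (hτσ j hj0 hjn).le
  have hτnn : ∀ j ≤ n, 0 ≤ τ j := fun j => by
    induction j with
    | zero => exact fun _ => hτ0.ge
    | succ j ih =>
      exact fun hj => (ih (by omega)).trans
        ((hstep j (by omega)).trans (hστ (j + 1) (by omega) hj).le)
  have hσL : ∀ j ≤ n, σ (j + 1) ≤ L := fun j hj => by
    induction hj using Nat.decreasingInduction with
    | self => exact hσlast.le
    | of_succ k hk ih =>
      exact ((hστ (k + 1) (by omega) hk).le.trans (hstep (k + 1) hk)).trans ih
  have hall : ∀ᶠ lam : ℝ in atBot, ∀ i ∈ Finset.Icc 1 n, ∀ u : ℝ → ℝ,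
      IsNonnegSol L p lam a u → sSup (u '' Ioo (σ i) (τ i)) ≠ ρ := by
    rw [eventually_all_finset]
    intro i hi
    obtain ⟨hi1, hin⟩ := Finset.mem_Icc.1 hi
    obtain ⟨j, rfl⟩ : ∃ j, i = j + 1 := ⟨i - 1, by omega⟩
    refine eventually_sSup_ne (hτnn j (by omega)) (hstep j (by omega)) (hστ _ hi1 hin)
      (hstep _ hin) (hσL _ hin) (fun h => ?_) (fun h => ?_) hp hρ ha (haneg j (by omega))
      (haneg (j + 1) hin)
    · rcases Nat.eq_zero_or_pos j with rfl | hj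
      · rw [← h, hτ0]
      · exact absurd h (hτσ j hj (by omega)).ne
    · rcases hin.eq_or_lt with hjn | hjn
      · rw [h, hjn, hσlast]
      · exact absurd h (hτσ (j + 1) hi1 hjn).ne
  obtain ⟨M, hM⟩ := eventually_atBot.1 hall
  refine ⟨min M (-1), (min_le_right _ _).trans_lt (by norm_num), ?_⟩
  intro lam hlam u hu i hi1 hin
  exact hM lam (hlam.le.trans (min_le_left _ _)) i (Finset.mem_Icc.2 ⟨hi1, hin⟩) u hu
end

section
/- Let λ ∈ ℝ, μ ≥ 0, and let w ∈ C([0,L]) with w ≥ 0. Set φ(x) := sin(πx/L) and Σ₁ := (π/L)². Then every function u ∈ C²([0,L]) with u ≥ 0, u(0) = u(L) = 0, and −u''(x) = λ u(x) + a(x) u(x)^p + μ w(x) for all x ∈ (0,L), satisfies μ ∫₀^L w(x) φ(x) dx ≤ [(Σ₁ − λ) + ‖a‖_{L^∞([0,L])} ‖u‖_{L^∞([0,L])}^{p−1}] · L · ‖u‖_{L^∞([0,L])}. -/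
open Set Real

theorem ContinuousOn.abs_le_supNorm {v : ℝ → ℝ} {K : Set ℝ} (hK : IsCompact K)
    (hv : ContinuousOn v K) {x : ℝ} (hx : x ∈ K) : |v x| ≤ supNorm v K :=
  le_csSup (hK.image_of_continuousOn hv.abs).bddAbove (mem_image_of_mem _ hx)

theorem sin_pi_mul_div_nonneg {L x : ℝ} (hL : 0 < L) (hx : x ∈ Icc 0 L) :
    0 ≤ Real.sin (π * x / L) := by
  apply Real.sin_nonneg_of_nonneg_of_le_pi
  · have := hx.1
    positivity
  · rw [div_le_iff₀ hL]
    exact mul_le_mul_of_nonneg_left hx.2 pi_pos.le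

theorem sin_pi_mul_div_pos {L x : ℝ} (hL : 0 < L) (hx : x ∈ Ioo 0 L) :
    0 < Real.sin (π * x / L) := by
  apply Real.sin_pos_of_pos_of_lt_pi
  · have := hx.1
    positivity
  · rw [div_lt_iff₀ hL]
    exact mul_lt_mul_of_pos_left hx.2 pi_pos

/-- Green's identity on `[0, L]` against the first Dirichlet eigenfunction. -/
theorem integral_deriv_deriv_add_mul_sin_eq_zero {L : ℝ} (hL : 0 < L) {u u' u'' : ℝ → ℝ}
    (hu1 : ∀ x ∈ Icc (0:ℝ) L, HasDerivWithinAt u (u' x) (Icc (0:ℝ) L) x)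
    (hu2 : ∀ x ∈ Icc (0:ℝ) L, HasDerivWithinAt u' (u'' x) (Icc (0:ℝ) L) x)
    (hu2c : ContinuousOn u'' (Icc (0:ℝ) L)) (hu0 : u 0 = 0) (huL : u L = 0) :
    ∫ x in (0:ℝ)..L, (u'' x + (π / L) ^ 2 * u x) * Real.sin (π * x / L) = 0 := by
  have hu : ContinuousOn u (Icc 0 L) := fun x hx => (hu1 x hx).continuousWithinAt
  have hu' : ContinuousOn u' (Icc 0 L) := fun x hx => (hu2 x hx).continuousWithinAt
  have key := intervalIntegral.integral_eq_sub_of_hasDerivAt_of_le hL.le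
    (f := fun x => u' x * Real.sin (π * x / L) - u x * (Real.cos (π * x / L) * (π / L)))
    (f' := fun x => (u'' x + (π / L) ^ 2 * u x) * Real.sin (π * x / L))
    (by fun_prop) ?_ ?_
  · rw [key]
    simp [hu0, huL, hL.ne']
  · intro x hx
    have hmem := Icc_mem_nhds hx.1 hx.2
    have h1 := (hu1 x (Ioo_subset_Icc_self hx)).hasDerivAt hmem
    have h2 := (hu2 x (Ioo_subset_Icc_self hx)).hasDerivAt hmem
    have hlin : HasDerivAt (fun x : ℝ => π * x / L) (π / L) x := by
      simpa using ((hasDerivAt_id x).const_mul π).div_const L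
    refine ((h2.mul hlin.sin).sub (h1.mul (hlin.cos.mul_const (π / L)))).congr_deriv ?_
    ring
  · apply ContinuousOn.intervalIntegrable_of_Icc hL.le
    fun_prop

theorem integral_estimate_against_first_eigenfunction
    (L p : ℝ) (hL : 0 < L) (hp : 1 < p)
    (a : ℝ → ℝ) (ha : ContinuousOn a (Icc 0 L))
    (lam μ : ℝ) (hμ : 0 ≤ μ)
    (w : ℝ → ℝ) (hwc : ContinuousOn w (Icc 0 L))
    (hwnn : ∀ x ∈ Icc (0:ℝ) L, 0 ≤ w x)
    (u u' u'' : ℝ → ℝ)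
    (hu1 : ∀ x ∈ Icc (0:ℝ) L, HasDerivWithinAt u (u' x) (Icc (0:ℝ) L) x)
    (hu2 : ∀ x ∈ Icc (0:ℝ) L, HasDerivWithinAt u' (u'' x) (Icc (0:ℝ) L) x)
    (hu2c : ContinuousOn u'' (Icc (0:ℝ) L))
    (hunn : ∀ x ∈ Icc (0:ℝ) L, 0 ≤ u x)
    (hu0 : u 0 = 0) (huL : u L = 0)
    (heq : ∀ x ∈ Ioo (0:ℝ) L, -u'' x = lam * u x + a x * u x ^ p + μ * w x) :
    μ * ∫ x in (0:ℝ)..L, w x * Real.sin (π * x / L) ≤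
      (((π / L) ^ 2 - lam) +
        supNorm a (Icc 0 L) * supNorm u (Icc 0 L) ^ (p - 1)) *
        L * supNorm u (Icc 0 L) := by
  have hu : ContinuousOn u (Icc 0 L) := fun x hx => (hu1 x hx).continuousWithinAt
  have hleM : ∀ x ∈ Icc (0:ℝ) L, u x ≤ supNorm u (Icc 0 L) := fun x hx =>
    (le_abs_self _).trans (hu.abs_le_supNorm isCompact_Icc hx)
  have hleA : ∀ x ∈ Icc (0:ℝ) L, |a x| ≤ supNorm a (Icc 0 L) := fun x hx =>
    ha.abs_le_supNorm isCompact_Icc hx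
  have hM : ∃ x ∈ Icc (0:ℝ) L, u x = supNorm u (Icc 0 L) := by
    obtain ⟨x, hx, hxM⟩ := (isCompact_Icc.image_of_continuousOn hu.abs).sSup_mem
      ((nonempty_Icc.2 hL.le).image _)
    exact ⟨x, hx, (abs_of_nonneg (hunn x hx)).symm.trans hxM⟩
  set M := supNorm u (Icc 0 L)
  set A := supNorm a (Icc 0 L)
  set B := (π / L) ^ 2 - lam + A * M ^ (p - 1) with hB
  have hM0 : 0 ≤ M := hu0.symm.le.trans (hleM 0 (left_mem_Icc.2 hL.le))
  have hA0 : 0 ≤ A := (abs_nonneg _).trans (hleA 0 (left_mem_Icc.2 hL.le))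
  have hpow : ∀ x ∈ Icc (0:ℝ) L, -(a x * u x ^ p) ≤ A * M ^ (p - 1) * u x := by
    intro x hx
    have hux := hunn x hx
    have hsplit : u x ^ p = u x ^ (p - 1) * u x := by
      rw [← Real.rpow_add_one' hux (by linarith), sub_add_cancel]
    calc -(a x * u x ^ p) = -a x * u x ^ (p - 1) * u x := by rw [hsplit]; ring
      _ ≤ A * M ^ (p - 1) * u x := by
        gcongr
        · exact (neg_le_abs _).trans (hleA x hx)
        · exact hleM x hx
  have hint_u : IntervalIntegrable (fun x => u x * Real.sin (π * x / L)) MeasureTheory.volume 0 L :=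
    ContinuousOn.intervalIntegrable_of_Icc hL.le (by fun_prop)
  have hint_green : IntervalIntegrable
      (fun x => (u'' x + (π / L) ^ 2 * u x) * Real.sin (π * x / L)) MeasureTheory.volume 0 L :=
    ContinuousOn.intervalIntegrable_of_Icc hL.le (by fun_prop)
  have hint_w : IntervalIntegrable (fun x => μ * (w x * Real.sin (π * x / L)))
      MeasureTheory.volume 0 L :=
    ContinuousOn.intervalIntegrable_of_Icc hL.le (by fun_prop)
  have hmain : μ * ∫ x in (0:ℝ)..L, w x * Real.sin (π * x / L) ≤
      B * ∫ x in (0:ℝ)..L, u x * Real.sin (π * x / L) := by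
    calc μ * ∫ x in (0:ℝ)..L, w x * Real.sin (π * x / L)
        = ∫ x in (0:ℝ)..L, μ * (w x * Real.sin (π * x / L)) := by
          rw [intervalIntegral.integral_const_mul]
      _ ≤ ∫ x in (0:ℝ)..L, (B * (u x * Real.sin (π * x / L)) -
            (u'' x + (π / L) ^ 2 * u x) * Real.sin (π * x / L)) := by
          refine intervalIntegral.integral_mono_on_of_le_Ioo hL.le hint_w
            ((hint_u.const_mul B).sub hint_green) fun x hx => ?_
          have hx' := Ioo_subset_Icc_self hx
          have hle : μ * w x ≤ B * u x - (u'' x + (π / L) ^ 2 * u x) := by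
            rw [hB]
            linarith [heq x hx, hpow x hx']
          linarith [mul_le_mul_of_nonneg_right hle (sin_pi_mul_div_nonneg hL hx')]
      _ = B * ∫ x in (0:ℝ)..L, u x * Real.sin (π * x / L) := by
          rw [intervalIntegral.integral_sub (hint_u.const_mul B) hint_green,
            integral_deriv_deriv_add_mul_sin_eq_zero hL hu1 hu2 hu2c hu0 huL,
            intervalIntegral.integral_const_mul, sub_zero]
  rcases le_or_gt 0 B with hB0 | hB0
  · have hI : ∫ x in (0:ℝ)..L, u x * Real.sin (π * x / L) ≤ L * M := by
      calc ∫ x in (0:ℝ)..L, u x * Real.sin (π * x / L)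
          ≤ ∫ _ in (0:ℝ)..L, M :=
            intervalIntegral.integral_mono_on hL.le hint_u intervalIntegrable_const fun x hx =>
              (mul_le_of_le_one_right (hunn x hx) (Real.sin_le_one _)).trans (hleM x hx)
        _ = L * M := by simp
    rw [mul_assoc]
    exact hmain.trans (mul_le_mul_of_nonneg_left hI hB0)
  · have hlhs : 0 ≤ μ * ∫ x in (0:ℝ)..L, w x * Real.sin (π * x / L) :=
      mul_nonneg hμ (intervalIntegral.integral_nonneg hL.le fun x hx =>
        mul_nonneg (hwnn x hx) (sin_pi_mul_div_nonneg hL hx))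
    have hI0 : 0 ≤ ∫ x in (0:ℝ)..L, u x * Real.sin (π * x / L) :=
      intervalIntegral.integral_nonneg hL.le fun x hx =>
        mul_nonneg (hunn x hx) (sin_pi_mul_div_nonneg hL hx)
    have hMzero : M = 0 := by
      by_contra hne
      obtain ⟨c, hc, hcM⟩ := hM
      have hcpos : 0 < u c := hcM ▸ hM0.lt_of_ne' hne
      have hc' : c ∈ Ioo 0 L :=
        ⟨hc.1.lt_of_ne' fun h => by simp [h, hu0] at hcpos,
          hc.2.lt_of_ne fun h => by simp [h, huL] at hcpos⟩
      have hIpos : 0 < ∫ x in (0:ℝ)..L, u x * Real.sin (π * x / L) :=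
        intervalIntegral.integral_pos hL (by fun_prop)
          (fun x hx => mul_nonneg (hunn x (Ioc_subset_Icc_self hx))
            (sin_pi_mul_div_nonneg hL (Ioc_subset_Icc_self hx)))
          ⟨c, hc, mul_pos hcpos (sin_pi_mul_div_pos hL hc')⟩
      linarith [mul_neg_of_neg_of_pos hB0 hIpos]
    rw [hMzero, mul_zero]
    exact hmain.trans (mul_nonpos_of_nonpos_of_nonneg hB0.le hI0)
end

section
/- Let λ < 0, ϑ ∈ (0,1], and let u ∈ C²([0,L]) with u ≥ 0, u not identically zero, u(0) = u(L) = 0, and −u''(x) = ϑ (λ u(x) + a(x) u(x)^p) for all x ∈ (0,L). If x₀ ∈ (0,L) is a point at which u attains its maximum over [0,L], then a(x₀) > 0 and a(x₀) · ‖u‖_{L^∞([0,L])}^{p−1} ≥ −λ. -/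
open Set

/-- Second-order necessary condition: the second derivative at a local maximum is nonpositive. -/
theorem IsLocalMax.second_deriv_nonpos {f f' : ℝ → ℝ} {c x : ℝ} (h : IsLocalMax f x)
    (hf : ∀ᶠ y in nhds x, HasDerivAt f (f' y) y) (hf' : HasDerivAt f' c x) : c ≤ 0 := by
  by_contra! hc
  have hd : deriv f =ᶠ[nhds x] f' := hf.mono fun y hy => hy.deriv
  have hdd : deriv (deriv f) x = c := hd.deriv_eq.trans hf'.deriv
  have hmin : IsLocalMin f x := isLocalMin_of_deriv_deriv_pos (hdd ▸ hc)
    h.deriv_eq_zero hf.self_of_nhds.continuousAt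
  have hconst : f =ᶠ[nhds x] fun _ => f x := by
    filter_upwards [h, hmin] with y h₁ h₂ using le_antisymm h₁ h₂
  have hzero : deriv (deriv f) x = 0 := by
    rw [hconst.deriv.deriv_eq]
    simp
  linarith

/-- A nonnegative function attaining its maximum on `K` at `x₀` has `L^∞`-norm `v x₀`. -/
theorem supNorm_eq_of_isMaxOn {v : ℝ → ℝ} {K : Set ℝ} {x₀ : ℝ} (hx₀ : x₀ ∈ K)
    (hnn : ∀ x ∈ K, 0 ≤ v x) (hmax : ∀ x ∈ K, v x ≤ v x₀) : supNorm v K = v x₀ := by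
  refine IsGreatest.csSup_eq ⟨⟨x₀, hx₀, abs_of_nonneg (hnn x₀ hx₀)⟩, ?_⟩
  rintro _ ⟨x, hx, rfl⟩
  exact (abs_of_nonneg (hnn x hx)).trans_le (hmax x hx)

theorem interior_maximum_forces_positive_weight
    (L p : ℝ) (hL : 0 < L) (hp : 1 < p)
    (a : ℝ → ℝ) (ha : ContinuousOn a (Icc 0 L))
    (lam : ℝ) (hlam : lam < 0)
    (ϑ : ℝ) (hϑ0 : 0 < ϑ) (hϑ1 : ϑ ≤ 1)
    (u u' u'' : ℝ → ℝ)
    (hu1 : ∀ x ∈ Icc (0:ℝ) L, HasDerivWithinAt u (u' x) (Icc (0:ℝ) L) x)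
    (hu2 : ∀ x ∈ Icc (0:ℝ) L, HasDerivWithinAt u' (u'' x) (Icc (0:ℝ) L) x)
    (hu2c : ContinuousOn u'' (Icc (0:ℝ) L))
    (hunn : ∀ x ∈ Icc (0:ℝ) L, 0 ≤ u x)
    (hune : ∃ x ∈ Icc (0:ℝ) L, u x ≠ 0)
    (hu0 : u 0 = 0) (huL : u L = 0)
    (heq : ∀ x ∈ Ioo (0:ℝ) L, -u'' x = ϑ * (lam * u x + a x * u x ^ p))
    (x₀ : ℝ) (hx₀ : x₀ ∈ Ioo (0:ℝ) L)
    (hmax : ∀ x ∈ Icc (0:ℝ) L, u x ≤ u x₀) :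
    0 < a x₀ ∧ -lam ≤ a x₀ * supNorm u (Icc 0 L) ^ (p - 1) := by
  have hmem : x₀ ∈ Icc (0:ℝ) L := Ioo_subset_Icc_self hx₀
  have hnhds : ∀ y ∈ Ioo (0:ℝ) L, Icc (0:ℝ) L ∈ nhds y := fun y hy => Icc_mem_nhds hy.1 hy.2
  have hpos : 0 < u x₀ := by
    obtain ⟨x, hx, hne⟩ := hune
    exact ((hunn x hx).lt_of_ne' hne).trans_le (hmax x hx)
  have hloc : IsLocalMax u x₀ := Filter.mem_of_superset (hnhds x₀ hx₀) hmax
  have hsecond : u'' x₀ ≤ 0 := by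
    refine hloc.second_deriv_nonpos ?_ ((hu2 x₀ hmem).hasDerivAt (hnhds x₀ hx₀))
    filter_upwards [Ioo_mem_nhds hx₀.1 hx₀.2] with y hy
    exact (hu1 y (Ioo_subset_Icc_self hy)).hasDerivAt (hnhds y hy)
  have hrhs : 0 ≤ u x₀ * (lam + a x₀ * u x₀ ^ (p - 1)) := by
    have hsplit : u x₀ ^ p = u x₀ * u x₀ ^ (p - 1) := by
      rw [Real.rpow_sub_one hpos.ne']
      field_simp
    have h : 0 ≤ ϑ * (lam * u x₀ + a x₀ * u x₀ ^ p) := by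
      rw [← heq x₀ hx₀]
      linarith
    have h' := nonneg_of_mul_nonneg_right h hϑ0
    rw [hsplit] at h'
    linarith
  have hbound : -lam ≤ a x₀ * u x₀ ^ (p - 1) := by
    linarith [nonneg_of_mul_nonneg_right hrhs hpos]
  rw [supNorm_eq_of_isMaxOn hmem hunn hmax]
  refine ⟨?_, hbound⟩
  exact pos_of_mul_pos_left (by linarith) (Real.rpow_pos_of_pos hpos (p - 1)).le
end
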